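/- arXiv:2309.10970 — 5 statements merged into one kernel-verified Lean document; each statement's English description precedes it below -/
import Mathlib

section
/- Let n be a positive integer, i, j nonnegative integers, and let a = (a_1,…,a_i), b = (b_1,…,b_j) be tuples of real parameters. Then for every x ≠ 0 the identity ₍i+1₎𝓕_j(-n, a; b; x) = ((-1)^{i+1} x)^n · ₍j+1₎𝓕_i(-n, -n-b+1; -n-a+1; (-1)^{i+j} / x) holds, where -n-b+1 and -n-a+1 denote the tuples with entries -n-b_s+1 and -n-a_s+1 respectively. -/
open Polynomial

/-- Generalized hypergeometric polynomial in standard normalization: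
`₍i+1₎𝓕_j(-n, a; b; x) = Σ_{k=0}^n (-n)_k (a)_k (b+k)_{n-k} x^k / k!`. -/
noncomputable def hyp (n : ℕ) {i j : ℕ} (a : Fin i → ℝ) (b : Fin j → ℝ) : Polynomial ℝ :=
  ∑ k ∈ Finset.range (n + 1),
    Polynomial.C (((ascPochhammer ℝ k).eval (-(n : ℝ)) *
        (∏ s, (ascPochhammer ℝ k).eval (a s)) *
        (∏ s, (ascPochhammer ℝ (n - k)).eval (b s + (k : ℝ)))) / (Nat.factorial k : ℝ)) *
      Polynomial.X ^ k

/-- The coefficient `e_k(p)` in the representation `p(x) = Σ_{k=0}^n (-1)^k e_k(p) x^{n-k}`. -/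
def eCoeff (n k : ℕ) (p : Polynomial ℝ) : ℝ := (-1 : ℝ) ^ k * p.coeff (n - k)

/-- Finite free multiplicative convolution `p ⊠_n q`. -/
noncomputable def ffMul (n : ℕ) (p q : Polynomial ℝ) : Polynomial ℝ :=
  ∑ k ∈ Finset.range (n + 1),
    Polynomial.C ((-1 : ℝ) ^ k * ((n.choose k : ℝ))⁻¹ * eCoeff n k p * eCoeff n k q) *
      Polynomial.X ^ (n - k)

/-- Finite free additive convolution `p ⊞_n q`. -/
noncomputable def ffAdd (n : ℕ) (p q : Polynomial ℝ) : Polynomial ℝ :=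
  ∑ k ∈ Finset.range (n + 1),
    Polynomial.C ((-1 : ℝ) ^ k *
      ∑ l ∈ Finset.range (k + 1),
        (((n - l).factorial : ℝ) * ((n - (k - l)).factorial : ℝ)) /
            ((n.factorial : ℝ) * ((n - k).factorial : ℝ)) *
          eCoeff n l p * eCoeff n (k - l) q) *
      Polynomial.X ^ (n - k)

/-- A real polynomial is real-rooted if all of its complex roots are real, i.e. the number of
real roots counted with multiplicity equals the degree. -/
def RealRooted (p : Polynomial ℝ) : Prop := p.roots.card = p.natDegree

/-- The real roots of `p`, with multiplicity, sorted in increasing order. -/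
noncomputable def sroots (p : Polynomial ℝ) : List ℝ := p.roots.sort (· ≤ ·)

/-- `p ⪯ q`: `p` and `q` are real-rooted of degree `n` and
`λ_1(p) ≤ λ_1(q) ≤ λ_2(p) ≤ … ≤ λ_n(p) ≤ λ_n(q)` (roots in increasing order). -/
noncomputable def Interlaces (n : ℕ) (p q : Polynomial ℝ) : Prop :=
  RealRooted p ∧ RealRooted q ∧ p.natDegree = n ∧ q.natDegree = n ∧
  (∀ k, k < n → (sroots p).getD k 0 ≤ (sroots q).getD k 0) ∧
  (∀ k, k + 1 < n → (sroots q).getD k 0 ≤ (sroots p).getD (k + 1) 0)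

/-- `p ≺ q`: strict interlacing. -/
noncomputable def StrictInterlaces (n : ℕ) (p q : Polynomial ℝ) : Prop :=
  RealRooted p ∧ RealRooted q ∧ p.natDegree = n ∧ q.natDegree = n ∧
  (∀ k, k < n → (sroots p).getD k 0 < (sroots q).getD k 0) ∧
  (∀ k, k + 1 < n → (sroots q).getD k 0 < (sroots p).getD (k + 1) 0)

/-- The mesh (minimal distance between roots) of a real-rooted polynomial with `n` roots. -/
noncomputable def mesh (n : ℕ) (p : Polynomial ℝ) : ℝ :=
  sInf {d : ℝ | ∃ k l : ℕ, k < l ∧ l < n ∧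
    d = |(sroots p).getD k 0 - (sroots p).getD l 0|}

/-- The logarithmic mesh (minimal ratio between consecutive decreasingly ordered roots) of a
polynomial with `n` positive roots. -/
noncomputable def lmesh (n : ℕ) (p : Polynomial ℝ) : ℝ :=
  sInf {d : ℝ | ∃ k : ℕ, k + 1 < n ∧
    d = (sroots p).getD (k + 1) 0 / (sroots p).getD k 0}

/-- Generalized Laguerre polynomial `L_n^{(α)}`. -/
noncomputable def Laguerre (n : ℕ) (α : ℝ) : Polynomial ℝ :=
  ∑ k ∈ Finset.range (n + 1),
    Polynomial.C ((descPochhammer ℝ (n - k)).eval ((n : ℝ) + α) /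
        ((k.factorial : ℝ) * ((n - k).factorial : ℝ)) * (-1 : ℝ) ^ k) *
      Polynomial.X ^ k

theorem asc_refl_aux (m : ℕ) (y z : ℝ) (h : z = 1 - m - y) :
    (ascPochhammer ℝ m).eval z = (-1 : ℝ) ^ m * (ascPochhammer ℝ m).eval y := by
  have h1 : z = -(y + m - 1) := by rw [h]; ring
  rw [h1, ascPochhammer_eval_neg_eq_descPochhammer, descPochhammer_eval_eq_ascPochhammer]
  congr 2
  ring

theorem asc_fact_aux (k m n : ℕ) (h : k + m = n) :
    (ascPochhammer ℝ k).eval (-(n : ℝ)) / (k.factorial : ℝ) =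
      (-1 : ℝ) ^ k * ((n.factorial : ℝ) / ((k.factorial : ℝ) * (m.factorial : ℝ))) := by
  subst h
  rw [asc_refl_aux k ((m + 1 : ℕ) : ℝ) _ (by push_cast; ring),
    ascPochhammer_nat_eq_natCast_ascFactorial, Nat.add_comm k m,
    ← Nat.factorial_mul_ascFactorial]
  have h1 : (k.factorial : ℝ) ≠ 0 := by positivity
  have h2 : (m.factorial : ℝ) ≠ 0 := by positivity
  push_cast
  field_simp

theorem hyp_eval_aux (n : ℕ) {i j : ℕ} (a : Fin i → ℝ) (b : Fin j → ℝ) (x : ℝ) :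
    (hyp n a b).eval x = ∑ k ∈ Finset.range (n + 1),
      ((ascPochhammer ℝ k).eval (-(n : ℝ)) / (Nat.factorial k : ℝ)) *
        (∏ s, (ascPochhammer ℝ k).eval (a s)) *
        (∏ s, (ascPochhammer ℝ (n - k)).eval (b s + (k : ℝ))) * x ^ k := by
  rw [hyp, Polynomial.eval_finsetSum]
  refine Finset.sum_congr rfl fun k _ => ?_
  simp only [Polynomial.eval_mul, Polynomial.eval_C, Polynomial.eval_pow, Polynomial.eval_X]
  ring

/-- the reversal identity
`₍i+1₎𝓕_j(-n, a; b; x) = ((-1)^{i+1} x)^n ₍j+1₎𝓕_i(-n, -n-b+1; -n-a+1; (-1)^{i+j}/x)`. -/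
theorem hyp_reversal (n : ℕ) (hn : 0 < n) {i j : ℕ} (a : Fin i → ℝ) (b : Fin j → ℝ)
    (x : ℝ) (hx : x ≠ 0) :
    (hyp n a b).eval x =
      ((-1 : ℝ) ^ (i + 1) * x) ^ n *
        (hyp n (fun s => -(n : ℝ) - b s + 1) (fun s => -(n : ℝ) - a s + 1)).eval
          ((-1 : ℝ) ^ (i + j) / x) := by
  rw [hyp_eval_aux, hyp_eval_aux, ← Finset.sum_range_reflect, Finset.mul_sum]
  refine Finset.sum_congr rfl fun m hm => ?_
  have hm' : m ≤ n := by simpa [Nat.lt_succ_iff] using hm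
  obtain ⟨k, rfl⟩ := Nat.exists_eq_add_of_le hm'
  have e1 : m + k + 1 - 1 - m = k := by omega
  have e2 : m + k - k = m := by omega
  have e3 : m + k - m = k := by omega
  rw [e1, e2, e3, asc_fact_aux k m (m + k) (by omega), asc_fact_aux m k (m + k) rfl]
  have hb : ∀ s, (ascPochhammer ℝ m).eval (-((m + k : ℕ) : ℝ) - b s + 1) =
      (-1 : ℝ) ^ m * (ascPochhammer ℝ m).eval (b s + k) := fun s =>
    asc_refl_aux _ _ _ (by push_cast; ring)
  have ha : ∀ s, (ascPochhammer ℝ k).eval (-((m + k : ℕ) : ℝ) - a s + 1 + m) =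
      (-1 : ℝ) ^ k * (ascPochhammer ℝ k).eval (a s) := fun s =>
    asc_refl_aux _ _ _ (by push_cast; ring)
  simp only [ha, hb, Finset.prod_mul_distrib, Finset.prod_const, Finset.card_univ,
    Fintype.card_fin]
  have hs : ((-1 : ℝ) ^ (i + 1) * x) ^ (m + k) * ((-1 : ℝ) ^ m * ((-1 : ℝ) ^ m) ^ j *
      ((-1 : ℝ) ^ k) ^ i * ((-1 : ℝ) ^ (i + j) / x) ^ m) = (-1 : ℝ) ^ k * x ^ k := by
    have hx2 : x ^ (m + k) = x ^ k * x ^ m := by ring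
    have hsg : ((-1 : ℝ) ^ (i + 1)) ^ (m + k) * ((-1 : ℝ) ^ m * ((-1 : ℝ) ^ m) ^ j *
      ((-1 : ℝ) ^ k) ^ i * ((-1 : ℝ) ^ (i + j)) ^ m) = (-1 : ℝ) ^ k := by
      simp only [← pow_mul, ← pow_add]
      have : (i + 1) * (m + k) + (m + m * j + k * i + (i + j) * m) =
          2 * (i * m + i * k + m + m * j) + k := by ring
      rw [this, pow_add, pow_mul]
      simp
    rw [mul_pow, div_pow, hx2]
    conv_rhs => rw [← hsg]
    have := pow_ne_zero m hx
    generalize x ^ m = y at *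
    field_simp
  linear_combination (-((m + k).factorial / (m.factorial * k.factorial : ℝ)) *
    (∏ s, (ascPochhammer ℝ k).eval (a s)) * (∏ s, (ascPochhammer ℝ m).eval (b s + k))) * hs
end

section
/- Let n be a positive integer and let a = (a_1,…,a_i), b = (b_1,…,b_j) be tuples of real parameters such that no a_s lies in {0,-1,…,-n+1}. Then ₍i+1₎𝓕_j(-n, a; b; x) = (-1)^n (a)_n · Σ_{k=0}^n [ (-b-n+1)_k / ( (-a-n+1)_k · k! ) ] · ((-1)^{i+j+1})^k · d^k/dx^k [x^n], where (-b-n+1)_k and (-a-n+1)_k denote products over tuple entries of rising factorials. -/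
open Polynomial

theorem asc_reflect (n k : ℕ) (hk : k ≤ n) (x : ℝ) :
    (ascPochhammer ℝ k).eval (-x - (n : ℝ) + 1)
      = (-1) ^ k * (ascPochhammer ℝ k).eval (x + ((n - k : ℕ) : ℝ)) := by
  have h := ascPochhammer_eval_neg_eq_descPochhammer ℝ (x + (n : ℝ) - 1) k
  rw [descPochhammer_eval_eq_ascPochhammer] at h
  rw [show -x - (n : ℝ) + 1 = -(x + n - 1) by ring, h, Nat.cast_sub hk]
  congr 2
  ring

theorem asc_split (n k : ℕ) (hk : k ≤ n) (x : ℝ) :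
    (ascPochhammer ℝ n).eval x = (ascPochhammer ℝ (n - k)).eval x *
      (ascPochhammer ℝ k).eval (x + ((n - k : ℕ) : ℝ)) := by
  have h := congrArg (Polynomial.eval x) (ascPochhammer_mul ℝ (n - k) k)
  rw [Nat.sub_add_cancel hk] at h
  rw [← h]
  simp

theorem asc_ne (n : ℕ) (x : ℝ) (h : ∀ m : ℕ, m < n → x ≠ -(m : ℝ)) :
    (ascPochhammer ℝ n).eval x ≠ 0 := by
  induction n with
  | zero => simp
  | succ n ih =>
    rw [ascPochhammer_succ_eval]
    refine mul_ne_zero (ih fun m hm => h m (by omega)) ?_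
    intro h0
    exact h n (by omega) (by linarith)

theorem asc_neg_nat (n k : ℕ) (hk : k ≤ n) :
    (ascPochhammer ℝ (n - k)).eval (-(n : ℝ))
      = (-1) ^ (n - k) * ((n.factorial : ℝ) / k.factorial) := by
  rw [ascPochhammer_eval_neg_eq_descPochhammer, descPochhammer_eval_eq_descFactorial]
  congr 1
  have h := Nat.factorial_mul_descFactorial (Nat.sub_le n k)
  rw [Nat.sub_sub_self hk] at h
  rw [← h]
  have := Nat.factorial_ne_zero k
  push_cast
  field_simp

/-- representation of a hypergeometric polynomial via a differential operator
applied to `x^n`. -/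
theorem hyp_diffOperator (n : ℕ) (hn : 0 < n) {i j : ℕ} (a : Fin i → ℝ) (b : Fin j → ℝ)
    (ha : ∀ s, ∀ m : ℕ, m < n → a s ≠ -(m : ℝ)) :
    hyp n a b =
      Polynomial.C ((-1 : ℝ) ^ n * ∏ s, (ascPochhammer ℝ n).eval (a s)) *
        ∑ k ∈ Finset.range (n + 1),
          Polynomial.C ((∏ s, (ascPochhammer ℝ k).eval (-(b s) - (n : ℝ) + 1)) /
              ((∏ s, (ascPochhammer ℝ k).eval (-(a s) - (n : ℝ) + 1)) * (k.factorial : ℝ)) *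
            ((-1 : ℝ) ^ (i + j + 1)) ^ k) *
          (Polynomial.derivative^[k] (Polynomial.X ^ n : Polynomial ℝ)) := by
  unfold hyp
  rw [← Finset.sum_range_reflect, Finset.mul_sum]
  refine Finset.sum_congr rfl fun k hk => ?_
  have hk : k ≤ n := by have := Finset.mem_range.1 hk; omega
  rw [show n + 1 - 1 - k = n - k by omega, Nat.sub_sub_self hk,
    Polynomial.iterate_derivative_X_pow_eq_C_mul, ← mul_assoc, ← mul_assoc, ← C_mul, ← C_mul]
  congr 2
  simp_rw [asc_reflect n k hk, asc_split n k hk (a _)]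
  rw [asc_neg_nat n k hk]
  simp only [Finset.prod_mul_distrib, Finset.prod_const, Finset.card_univ, Fintype.card_fin]
  have hA : ∏ s, (ascPochhammer ℝ k).eval (a s + ((n - k : ℕ) : ℝ)) ≠ 0 := by
    refine Finset.prod_ne_zero_iff.2 fun s _ => ?_
    have := asc_ne n (a s) (ha s)
    rw [asc_split n k hk] at this
    exact right_ne_zero_of_mul this
  generalize ∏ s, (ascPochhammer ℝ k).eval (a s + ((n - k : ℕ) : ℝ)) = A at *
  generalize ∏ s, (ascPochhammer ℝ k).eval (b s + ((n - k : ℕ) : ℝ)) = B at *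
  generalize ∏ s, (ascPochhammer ℝ (n - k)).eval (a s) = A' at *
  have hd : (n.descFactorial k : ℝ) = n.factorial / (n - k).factorial := by
    have h := Nat.factorial_mul_descFactorial hk
    rw [← h]
    have := Nat.factorial_ne_zero (n - k)
    push_cast
    field_simp
  rw [hd]
  have h1 := Nat.factorial_ne_zero k
  have h2 := Nat.factorial_ne_zero (n - k)
  have e1 : (-1 : ℝ) ^ n = (-1) ^ (n - k) * (-1) ^ k := by
    rw [← pow_add, Nat.sub_add_cancel hk]
  have e2 : ((-1 : ℝ) ^ (i + j + 1)) ^ k = ((-1) ^ k) ^ i * ((-1) ^ k) ^ j * (-1) ^ k := by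
    rw [← pow_mul, ← pow_mul, ← pow_mul, ← pow_add, ← pow_add]; congr 1; ring
  rw [e1, e2]
  rcases neg_one_pow_eq_or ℝ k with h | h <;> rw [h]
  · simp
    field_simp
  · have q : ((-1 : ℝ) ^ j) * (-1) ^ j = 1 := by rw [← mul_pow]; simp
    have hi : ((-1 : ℝ) ^ i) ≠ 0 := by simp
    field_simp
    linear_combination (-(A' * B)) * q
end

section
/- Let p and q be real-rooted real polynomials, both of degree exactly n. Then (p ⪯ q or q ⪯ p) holds if and only if for every pair of reals α, β the polynomial α p + β q has all its complex roots real. Moreover, if additionally p and q have no common root, the equivalence holds with ⪯ replaced by strict interlacing ≺ and with the right-hand side strengthened to: for all (α, β) ≠ (0,0) the polynomial α p + β q has only real simple zeros. -/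
open Polynomial

lemma cnt_list (l : List ℝ) (hl : l.Pairwise (· ≤ ·)) (x : ℝ) :
    ∀ k, k < l.length → (l.getD k 0 ≤ x ↔ k < l.countP (fun y => decide (y ≤ x))) := by
  induction l with
  | nil => intro k hk; simp at hk
  | cons a t ih =>
    rw [List.pairwise_cons] at hl
    intro k hk
    by_cases ha : a ≤ x
    · rw [List.countP_cons_of_pos (by simpa using ha)]
      cases k with
      | zero => simpa using ha
      | succ k =>
        have := ih hl.2 k (by simpa using hk)
        simp only [List.getD_cons_succ, Nat.add_lt_add_iff_right]
        exact this
    · have h0 : t.countP (fun y => decide (y ≤ x)) = 0 := by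
        rw [List.countP_eq_zero]
        intro b hb
        have := hl.1 b hb
        simp only [decide_eq_true_eq, not_le] at *
        linarith
      rw [List.countP_cons_of_neg (by simpa using ha), h0]
      constructor
      · intro h
        exfalso
        cases k with
        | zero => exact ha (by simpa using h)
        | succ k =>
          have := (ih hl.2 k (by simpa using hk)).1 (by simpa using h)
          omega
      · intro h; omega

noncomputable def cnt (p : Polynomial ℝ) (x : ℝ) : ℕ := p.roots.countP (fun y => y ≤ x)

lemma sroots_length (p : Polynomial ℝ) : (sroots p).length = p.roots.card := by
  simp [sroots]

lemma cnt_key (p : Polynomial ℝ) (x : ℝ) (k : ℕ) (hk : k < p.roots.card) :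
    (sroots p).getD k 0 ≤ x ↔ k < cnt p x := by
  have := cnt_list (sroots p) (Multiset.pairwise_sort _ _) x k (by rwa [sroots_length])
  rw [this, cnt]
  conv_rhs => rw [← Multiset.sort_eq p.roots (· ≤ ·)]
  rw [Multiset.coe_countP]
  rfl

lemma cnt_le (p : Polynomial ℝ) (x : ℝ) : cnt p x ≤ p.roots.card := Multiset.countP_le_card _ _

lemma interl_iff (n : ℕ) (p q : Polynomial ℝ) (hp : RealRooted p) (hq : RealRooted q)
    (hpd : p.natDegree = n) (hqd : q.natDegree = n) :
    Interlaces n p q ↔ ∀ x, cnt q x ≤ cnt p x ∧ cnt p x ≤ cnt q x + 1 := by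
  have hpc : p.roots.card = n := by rw [← hpd]; exact hp
  have hqc : q.roots.card = n := by rw [← hqd]; exact hq
  constructor
  · rintro ⟨-, -, -, -, h1, h2⟩ x
    constructor
    · by_contra! h
      have hk : cnt p x < n := by have := cnt_le q x; omega
      have := (cnt_key q x _ (by omega)).2 h
      have := (cnt_key p x _ (by omega)).1 ((h1 _ hk).trans this)
      omega
    · by_contra! h
      have hk : cnt q x + 1 < n := by have := cnt_le p x; omega
      have := (cnt_key p x _ (by omega)).2 h
      have := (cnt_key q x _ (by omega)).1 ((h2 _ hk).trans this)
      omega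
  · intro h
    refine ⟨hp, hq, hpd, hqd, fun k hk => ?_, fun k hk => ?_⟩
    · rw [cnt_key p _ k (by omega)]
      exact ((cnt_key q _ k (by omega)).1 le_rfl).trans_le (h _).1
    · rw [cnt_key q _ k (by omega)]
      have := (cnt_key p _ (k+1) (by omega)).1 le_rfl
      have := (h ((sroots p).getD (k+1) 0)).2
      omega

lemma rr_mul (r : ℝ) (h : Polynomial ℝ) : RealRooted ((X - C r) * h) ↔ RealRooted h := by
  by_cases h0 : h = 0
  · simp [h0]
  have hne : (X - C r) * h ≠ 0 := mul_ne_zero (X_sub_C_ne_zero r) h0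
  unfold RealRooted
  rw [roots_mul hne, natDegree_mul (X_sub_C_ne_zero r) h0, roots_X_sub_C, natDegree_X_sub_C]
  simp
  omega

lemma cnt_mul (r : ℝ) (h : Polynomial ℝ) (h0 : h ≠ 0) (x : ℝ) :
    cnt ((X - C r) * h) x = cnt h x + if r ≤ x then 1 else 0 := by
  have hne : (X - C r) * h ≠ 0 := mul_ne_zero (X_sub_C_ne_zero r) h0
  unfold cnt
  rw [roots_mul hne, roots_X_sub_C, Multiset.singleton_add, Multiset.countP_cons]

lemma interl_mul (n : ℕ) (r : ℝ) (p q : Polynomial ℝ) (hp : RealRooted p) (hq : RealRooted q)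
    (hpd : p.natDegree = n) (hqd : q.natDegree = n) (hp0 : p ≠ 0) (hq0 : q ≠ 0) :
    Interlaces (n+1) ((X - C r) * p) ((X - C r) * q) ↔ Interlaces n p q := by
  rw [interl_iff n p q hp hq hpd hqd, interl_iff (n+1)]
  · simp only [cnt_mul r p hp0, cnt_mul r q hq0]
    constructor <;> intro h x <;> have := h x <;> constructor <;> omega
  · rwa [rr_mul]
  · rwa [rr_mul]
  · rw [natDegree_mul (X_sub_C_ne_zero r) hp0, natDegree_X_sub_C]; omega
  · rw [natDegree_mul (X_sub_C_ne_zero r) hq0, natDegree_X_sub_C]; omega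

lemma rr_im (h : Polynomial ℝ) (hh : RealRooted h) (h0 : h ≠ 0) (z : ℂ) (hz : aeval z h = 0) :
    z.im = 0 := by
  rw [← C_leadingCoeff_mul_prod_multiset_X_sub_C hh] at hz
  rw [map_mul, aeval_C, mul_eq_zero] at hz
  rcases hz with hz | hz
  · simp [h0] at hz
  · rw [map_multiset_prod, Multiset.prod_eq_zero_iff, Multiset.map_map, Multiset.mem_map] at hz
    obtain ⟨a, -, ha⟩ := hz
    simp [sub_eq_zero] at ha
    rw [ha]; simp

lemma keyC_real (f g : Polynomial ℝ) (hall : ∀ α β : ℝ, RealRooted (C α * f + C β * g))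
    (hne : ∀ α β : ℝ, C α * f + C β * g = 0 → α = 0 ∧ β = 0)
    (z : ℂ) (hz : z.im ≠ 0) : (aeval z f * (starRingEnd ℂ) (aeval z g)).im ≠ 0 := by
  intro h
  have key : ∀ α β : ℝ, (α:ℂ) * aeval z f + β * aeval z g = 0 → α = 0 ∧ β = 0 := by
    intro α β hab
    by_contra hc
    refine hz (rr_im _ (hall α β) (fun h => hc (hne _ _ h)) z ?_)
    simpa using hab
  have hg : aeval z g ≠ 0 := by
    intro hg
    have := (key 0 1 (by simp [hg])).2
    norm_num at this
  have h1 : ((aeval z f * (starRingEnd ℂ) (aeval z g)).re : ℂ) =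
      aeval z f * (starRingEnd ℂ) (aeval z g) := by
    apply Complex.ext
    · simp
    · rw [h, Complex.ofReal_im]
  have h2 := key (Complex.normSq (aeval z g)) (-(aeval z f * (starRingEnd ℂ) (aeval z g)).re) (by
    rw [Complex.ofReal_neg, h1, Complex.normSq_eq_conj_mul_self]; ring)
  exact hg (Complex.normSq_eq_zero.1 h2.1)

lemma keyC (f g : Polynomial ℝ) (hall : ∀ α β : ℝ, RealRooted (C α * f + C β * g))
    (hf : f ≠ 0) (x₀ : ℝ) (hg : g.eval x₀ ≠ 0) : f.rootMultiplicity x₀ ≤ 1 := by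
  by_contra! hm
  set m := f.rootMultiplicity x₀ with hmdef
  obtain ⟨u, hu, hu'⟩ := exists_eq_pow_rootMultiplicity_mul_and_not_dvd f hf x₀
  rw [← hmdef] at hu
  rw [dvd_iff_isRoot, IsRoot.def] at hu'
  have hfx : f.eval x₀ = 0 := by
    rw [hu]; simp; left; omega
  have hne : ∀ α β : ℝ, C α * f + C β * g = 0 → α = 0 ∧ β = 0 := by
    intro α β h
    have h1 := congrArg (eval x₀) h
    simp [hfx, hg] at h1
    subst h1
    simp [hf] at h
    exact ⟨h, rfl⟩
  let z : ℝ → ℝ → ℂ := fun r θ => x₀ + r * Complex.exp (θ * Complex.I)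
  have zc : Continuous (fun a : ℝ × ℝ => z a.1 a.2) := by fun_prop
  let F : ℝ → ℝ → ℝ := fun r θ => (Complex.exp ((m * θ : ℝ) * Complex.I) *
    aeval (z r θ) u * (starRingEnd ℂ) (aeval (z r θ) g)).im
  have Fc : Continuous (fun a : ℝ × ℝ => F a.1 a.2) := by
    have h1 : Continuous (fun a : ℝ × ℝ => aeval (z a.1 a.2) u) := (u.continuous_aeval).comp zc
    have h2 : Continuous (fun a : ℝ × ℝ => aeval (z a.1 a.2) g) := (g.continuous_aeval).comp zc
    refine Complex.continuous_im.comp ?_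
    refine Continuous.mul (Continuous.mul (by fun_prop) h1) (Complex.continuous_conj.comp h2)
  have F0 : ∀ θ, F 0 θ = Real.sin (m * θ) * (u.eval x₀ * g.eval x₀) := by
    intro θ
    have e : ∀ w : Polynomial ℝ, aeval (z 0 θ) w = ((w.eval x₀ : ℝ) : ℂ) := by
      intro w
      have : z 0 θ = algebraMap ℝ ℂ x₀ := by simp [z]
      rw [this, aeval_algebraMap_apply]; simp
    simp only [F, e, Complex.conj_ofReal]
    rw [mul_assoc, ← Complex.ofReal_mul, Complex.im_mul_ofReal, Complex.exp_ofReal_mul_I_im]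
  set K := u.eval x₀ * g.eval x₀ with hK
  have hK0 : K ≠ 0 := mul_ne_zero hu' hg
  have mpos : (0:ℝ) < m := by exact_mod_cast (by omega : 0 < m)
  set t1 := Real.pi / (2 * m)
  set t2 := 3 * Real.pi / (2 * m)
  have e1 : F 0 t1 = K := by
    rw [F0, show (m:ℝ) * t1 = Real.pi / 2 by simp only [t1]; field_simp]; simp
  have e2 : F 0 t2 = -K := by
    rw [F0, show (m:ℝ) * t2 = Real.pi / 2 + Real.pi by simp only [t2]; field_simp; ring]
    rw [Real.sin_add_pi]; simp
  have hprod : F 0 t1 * F 0 t2 < 0 := by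
    rw [e1, e2]; have := mul_self_pos.2 hK0; linarith
  have hcont : Continuous (fun r => F r t1 * F r t2) :=
    (Fc.comp (f := fun r : ℝ => (r, t1)) (by fun_prop)).mul
      (Fc.comp (f := fun r : ℝ => (r, t2)) (by fun_prop))
  have hev : ∀ᶠ r in nhdsWithin (0:ℝ) (Set.Ioi 0), F r t1 * F r t2 < 0 :=
    nhdsWithin_le_nhds (hcont.continuousAt.eventually (gt_mem_nhds hprod))
  obtain ⟨r, hr, hr0⟩ := (hev.and self_mem_nhdsWithin).exists
  have hr0 : 0 < r := hr0
  have Fc' : Continuous (F r) := Fc.comp (f := fun θ : ℝ => (r, θ)) (by fun_prop)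
  have ht1 : 0 < t1 := by have := Real.pi_pos; positivity
  have ht12 : t1 ≤ t2 := by
    simp only [t1, t2]
    gcongr
    linarith [Real.pi_pos]
  have ht2 : t2 < Real.pi := by
    simp only [t2]
    rw [div_lt_iff₀ (by positivity)]
    have : (2:ℝ) ≤ m := by exact_mod_cast hm
    nlinarith [Real.pi_pos]
  obtain ⟨θ, hθ, hF⟩ : ∃ θ ∈ Set.Icc t1 t2, F r θ = 0 := by
    rcases mul_neg_iff.1 hr with h | h
    · exact intermediate_value_Icc' ht12 Fc'.continuousOn ⟨h.2.le, h.1.le⟩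
    · exact intermediate_value_Icc ht12 Fc'.continuousOn ⟨h.1.le, h.2.le⟩
  have him : (z r θ).im ≠ 0 := by
    simp only [z, Complex.add_im, Complex.ofReal_im, Complex.im_ofReal_mul,
      Complex.exp_ofReal_mul_I_im]
    have := Real.sin_pos_of_pos_of_lt_pi (x := θ) (by linarith [hθ.1]) (by linarith [hθ.2])
    positivity
  refine keyC_real f g hall hne (z r θ) him ?_
  have hz : aeval (z r θ) f = ((r^m : ℝ) : ℂ) * (Complex.exp ((m * θ : ℝ) * Complex.I) *
    aeval (z r θ) u) := by
    rw [hu]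
    simp only [map_mul, map_pow, map_sub, aeval_X, aeval_C, z]
    simp only [Complex.coe_algebraMap, add_sub_cancel_left, mul_pow, ← Complex.exp_nat_mul]
    push_cast
    rw [mul_assoc, mul_assoc (m:ℂ)]
  rw [hz, mul_assoc, Complex.im_ofReal_mul]
  exact mul_eq_zero_of_right _ hF

lemma nodup_of_all (p q : Polynomial ℝ) (hc : ∀ x : ℝ, ¬ (p.IsRoot x ∧ q.IsRoot x))
    (hall : ∀ α β : ℝ, RealRooted (C α * p + C β * q)) (α β : ℝ) :
    (C α * p + C β * q).roots.Nodup := by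
  by_cases h0 : C α * p + C β * q = 0
  · rw [h0]; simp
  rw [Multiset.nodup_iff_count_le_one]
  intro x
  rw [count_roots]
  by_cases hr : (C α * p + C β * q).IsRoot x
  swap
  · rw [rootMultiplicity_eq_zero hr]; omega
  refine keyC _ (C (-β) * p + C α * q) ?_ h0 x ?_
  · intro a b
    convert hall (a * α - b * β) (a * β + b * α) using 1
    simp only [C_add, C_mul, C_sub, C_neg]; ring
  · intro hg
    have hr : α * p.eval x + β * q.eval x = 0 := by simpa using hr
    have hg : -β * p.eval x + α * q.eval x = 0 := by simpa using hg
    have hne : α^2 + β^2 ≠ 0 := by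
      intro h
      have ha : α = 0 := by nlinarith [sq_nonneg α, sq_nonneg β]
      have hb : β = 0 := by nlinarith [sq_nonneg α, sq_nonneg β]
      apply h0; simp [ha, hb]
    refine hc x ⟨?_, ?_⟩
    · have : (α^2 + β^2) * p.eval x = 0 := by linear_combination α * hr - β * hg
      exact (mul_eq_zero.1 this).resolve_left hne
    · have : (α^2 + β^2) * q.eval x = 0 := by linear_combination β * hr + α * hg
      exact (mul_eq_zero.1 this).resolve_left hne

lemma between (p q : Polynomial ℝ) (hc : ∀ x : ℝ, ¬ (p.IsRoot x ∧ q.IsRoot x))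
    (hall : ∀ α β : ℝ, RealRooted (C α * p + C β * q)) (hp : p ≠ 0) (a b : ℝ) (hab : a < b)
    (ha : p.eval a = 0) (hb : p.eval b = 0) : ∃ c, a < c ∧ c < b ∧ q.eval c = 0 := by
  by_contra! hno
  have hq : ∀ x ∈ Set.Icc a b, q.eval x ≠ 0 := by
    intro x hx h
    rcases eq_or_lt_of_le hx.1 with h1 | h1
    · exact hc a ⟨ha, h1 ▸ h⟩
    rcases eq_or_lt_of_le hx.2 with h2 | h2
    · exact hc b ⟨hb, h2 ▸ h⟩
    exact hno x h1 h2 h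
  obtain ⟨ξ, hξ, hd⟩ := exists_hasDerivAt_eq_zero (f := fun x => p.eval x / q.eval x)
    (f' := fun x => (p.derivative.eval x * q.eval x - p.eval x * q.derivative.eval x)
      / (q.eval x)^2) hab
    (p.continuousOn.div q.continuousOn hq) (by simp [ha, hb])
    (fun x hx => (p.hasDerivAt x).div (q.hasDerivAt x) (hq x ⟨hx.1.le, hx.2.le⟩))
  have hqξ := hq ξ ⟨hξ.1.le, hξ.2.le⟩
  have hqa := hq a ⟨le_rfl, hab.le⟩
  rw [div_eq_zero_iff] at hd
  have hd := hd.resolve_right (pow_ne_zero 2 hqξ)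
  set α := q.eval ξ
  set β := - p.eval ξ with hβ
  have hh0 : C α * p + C β * q ≠ 0 := by
    intro h
    have h1 := congrArg (eval a) h
    simp [ha, hqa] at h1
    rw [h1] at h
    simp [hqξ, hp] at h
  have hnd := nodup_of_all p q hc hall α β
  rw [Multiset.nodup_iff_count_le_one] at hnd
  have := hnd ξ
  rw [count_roots] at this
  have h2 := (one_lt_rootMultiplicity_iff_isRoot hh0 (t := ξ)).2 ⟨by
    simp [α, hβ]; ring, by simp [α, hβ] at *; linarith⟩
  omega

lemma mem_sroots (p : Polynomial ℝ) (hp : p ≠ 0) (x : ℝ) :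
    p.eval x = 0 ↔ ∃ k, k < p.roots.card ∧ (sroots p).getD k 0 = x := by
  have : p.eval x = 0 ↔ x ∈ sroots p := by simp [sroots, hp]
  rw [this, List.mem_iff_getElem]
  constructor
  · rintro ⟨k, hk, h⟩
    refine ⟨k, by rwa [← sroots_length], ?_⟩
    rw [List.getD_eq_getElem _ _ hk]; exact h
  · rintro ⟨k, hk, h⟩
    rw [← sroots_length] at hk
    refine ⟨k, hk, ?_⟩
    rwa [List.getD_eq_getElem _ _ hk] at h

lemma sroots_mono (p : Polynomial ℝ) (i j : ℕ) (hij : i ≤ j) (hj : j < p.roots.card) :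
    (sroots p).getD i 0 ≤ (sroots p).getD j 0 := by
  rw [cnt_key _ _ _ (by omega)]
  have := (cnt_key p _ j hj).1 le_rfl
  omega

lemma sroots_strict (p : Polynomial ℝ) (hn : p.roots.Nodup) (i j : ℕ) (hij : i < j)
    (hj : j < p.roots.card) :
    (sroots p).getD i 0 < (sroots p).getD j 0 := by
  refine lt_of_le_of_ne (sroots_mono p i j hij.le hj) ?_
  rw [← sroots_length] at hj
  rw [List.getD_eq_getElem _ _ (hij.trans hj), List.getD_eq_getElem _ _ hj]
  have hnd : (sroots p).Nodup := by
    rw [← Multiset.coe_nodup, sroots, Multiset.sort_eq]; exact hn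
  intro h
  have := (hnd.getElem_inj_iff).1 h
  omega

lemma comb (n : ℕ) (a b : ℕ → ℝ)
    (ha : ∀ i j, i < j → j < n → a i < a j) (hb : ∀ i j, i < j → j < n → b i < b j)
    (hab : ∀ k, k + 1 < n → ∃ j < n, a k < b j ∧ b j < a (k+1))
    (hba : ∀ k, k + 1 < n → ∃ j < n, b k < a j ∧ a j < b (k+1))
    (h0 : a 0 < b 0) : (∀ k, k < n → a k < b k) ∧ (∀ k, k + 1 < n → b k < a (k+1)) := by
  have hmono : ∀ (c : ℕ → ℝ), (∀ i j, i < j → j < n → c i < c j) → ∀ i j, j < n → c i < c j →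
      i < n → i < j := by
    intro c hc i j hj h hi
    by_contra! hle
    rcases eq_or_lt_of_le hle with e | e
    · subst e; exact lt_irrefl _ h
    · exact lt_asymm h (hc _ _ e hi)
  have step : ∀ k, k + 1 < n → a k < b k → (k = 0 ∨ b (k-1) < a k) → b k < a (k+1) := by
    intro k hk h1 h2
    obtain ⟨j, hj, hj1, hj2⟩ := hab k hk
    have hkj : k ≤ j := by
      rcases h2 with h2 | h2
      · omega
      · have := hmono b hb (k-1) j hj (h2.trans hj1) (by omega)
        omega
    rcases eq_or_lt_of_le hkj with e | e
    · subst e; exact hj2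
    · exact (hb _ _ e hj).trans hj2
  have main : ∀ k, k < n → a k < b k ∧ (k = 0 ∨ b (k-1) < a k) := by
    intro k
    induction k with
    | zero => intro _; exact ⟨h0, Or.inl rfl⟩
    | succ k ih =>
      intro hk
      have ⟨h1, h2⟩ := ih (by omega)
      have h3 := step k hk h1 h2
      refine ⟨?_, Or.inr (by simpa using h3)⟩
      obtain ⟨j, hj, hj1, hj2⟩ := hba k hk
      have := hmono a ha k j hj (h1.trans hj1) (by omega)
      rcases eq_or_lt_of_le (show k + 1 ≤ j from this) with e | e
      · subst e; exact hj2
      · exact (ha _ _ e hj).trans hj2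
  exact ⟨fun k hk => (main k hk).1, fun k hk => step k hk (main k (by omega)).1
    (main k (by omega)).2⟩

lemma strict_of_weak (n : ℕ) (p q : Polynomial ℝ) (hc : ∀ x : ℝ, ¬ (p.IsRoot x ∧ q.IsRoot x))
    (h : Interlaces n p q) : StrictInterlaces n p q := by
  obtain ⟨hp, hq, hpd, hqd, h1, h2⟩ := h
  have hpc : p.roots.card = n := by rw [← hpd]; exact hp
  have hqc : q.roots.card = n := by rw [← hqd]; exact hq
  have ne : ∀ i j, i < n → j < n → (sroots p).getD i 0 ≠ (sroots q).getD j 0 := by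
    intro i j hi hj h
    have hp0 : p ≠ 0 := by rintro rfl; simp at hpc; omega
    have hq0 : q ≠ 0 := by rintro rfl; simp at hqc; omega
    exact hc _ ⟨(mem_sroots p hp0 _).2 ⟨i, by omega, rfl⟩,
      (mem_sroots q hq0 _).2 ⟨j, by omega, h.symm⟩⟩
  exact ⟨hp, hq, hpd, hqd, fun k hk => lt_of_le_of_ne (h1 k hk) (ne _ _ hk hk),
    fun k hk => lt_of_le_of_ne (h2 k hk) (ne _ _ hk (by omega)).symm⟩

lemma weak_of_strict (n : ℕ) (p q : Polynomial ℝ)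
    (h : StrictInterlaces n p q) : Interlaces n p q := by
  obtain ⟨hp, hq, hpd, hqd, h1, h2⟩ := h
  exact ⟨hp, hq, hpd, hqd, fun k hk => (h1 k hk).le, fun k hk => (h2 k hk).le⟩

lemma core_back (n : ℕ) (hn : 0 < n) (p q : Polynomial ℝ)
    (hpd : p.natDegree = n) (hqd : q.natDegree = n)
    (hp : RealRooted p) (hq : RealRooted q) (hc : ∀ x : ℝ, ¬ (p.IsRoot x ∧ q.IsRoot x))
    (hall : ∀ α β : ℝ, RealRooted (C α * p + C β * q)) :
    StrictInterlaces n p q ∨ StrictInterlaces n q p := by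
  have hpc : p.roots.card = n := by rw [← hpd]; exact hp
  have hqc : q.roots.card = n := by rw [← hqd]; exact hq
  have hp0 : p ≠ 0 := by rintro rfl; simp at hpc; omega
  have hq0 : q ≠ 0 := by rintro rfl; simp at hqc; omega
  have hc' : ∀ x : ℝ, ¬ (q.IsRoot x ∧ p.IsRoot x) := fun x h => hc x h.symm
  have hall' : ∀ α β : ℝ, RealRooted (C α * q + C β * p) := by
    intro α β; rw [add_comm]; exact hall β α
  have hpn : p.roots.Nodup := by simpa using nodup_of_all p q hc hall 1 0
  have hqn : q.roots.Nodup := by simpa using nodup_of_all p q hc hall 0 1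
  have ha : ∀ i j, i < j → j < n → (sroots p).getD i 0 < (sroots p).getD j 0 :=
    fun i j hij hj => sroots_strict p hpn i j hij (by omega)
  have hb : ∀ i j, i < j → j < n → (sroots q).getD i 0 < (sroots q).getD j 0 :=
    fun i j hij hj => sroots_strict q hqn i j hij (by omega)
  have rp : ∀ i, i < n → p.eval ((sroots p).getD i 0) = 0 :=
    fun i hi => (mem_sroots p hp0 _).2 ⟨i, by omega, rfl⟩
  have rq : ∀ i, i < n → q.eval ((sroots q).getD i 0) = 0 :=
    fun i hi => (mem_sroots q hq0 _).2 ⟨i, by omega, rfl⟩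
  have hab : ∀ k, k + 1 < n → ∃ j < n, (sroots p).getD k 0 < (sroots q).getD j 0 ∧
      (sroots q).getD j 0 < (sroots p).getD (k+1) 0 := by
    intro k hk
    obtain ⟨c, h1, h2, h3⟩ := between p q hc hall hp0 _ _ (ha k (k+1) (by omega) hk)
      (rp k (by omega)) (rp _ hk)
    obtain ⟨j, hj, rfl⟩ := (mem_sroots q hq0 c).1 h3
    exact ⟨j, by omega, h1, h2⟩
  have hba : ∀ k, k + 1 < n → ∃ j < n, (sroots q).getD k 0 < (sroots p).getD j 0 ∧
      (sroots p).getD j 0 < (sroots q).getD (k+1) 0 := by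
    intro k hk
    obtain ⟨c, h1, h2, h3⟩ := between q p hc' hall' hq0 _ _ (hb k (k+1) (by omega) hk)
      (rq k (by omega)) (rq _ hk)
    obtain ⟨j, hj, rfl⟩ := (mem_sroots p hp0 c).1 h3
    exact ⟨j, by omega, h1, h2⟩
  rcases lt_trichotomy ((sroots p).getD 0 0) ((sroots q).getD 0 0) with h | h | h
  · left
    obtain ⟨h1, h2⟩ := comb n (fun k => (sroots p).getD k 0) (fun k => (sroots q).getD k 0)
      ha hb hab hba h
    exact ⟨hp, hq, hpd, hqd, h1, h2⟩
  · exact absurd ⟨rp 0 hn, h ▸ rq 0 hn⟩ (hc _)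
  · right
    obtain ⟨h1, h2⟩ := comb n (fun k => (sroots q).getD k 0) (fun k => (sroots p).getD k 0)
      hb ha hba hab h
    exact ⟨hq, hp, hqd, hpd, h1, h2⟩

lemma rr_of_card (f : Polynomial ℝ) (h : f.natDegree ≤ f.roots.card + 1) : RealRooted f := by
  by_cases hf : f = 0
  · simp [hf, RealRooted]
  obtain ⟨g, h1, h2, h3⟩ := exists_prod_multiset_X_sub_C_mul f
  have hg1 : g.natDegree ≤ 1 := by omega
  have hg : g.natDegree ≠ 1 := by
    intro hg
    have hd : g.degree = 1 :=
      (degree_eq_iff_natDegree_eq_of_pos one_pos).2 hg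
    obtain ⟨x, hx⟩ := exists_root_of_degree_eq_one hd
    have hg0 : g ≠ 0 := by rintro rfl; simp at hg
    have := (mem_roots hg0).2 hx
    rw [h3] at this; simp at this
  unfold RealRooted
  omega

lemma eval_sroots (q : Polynomial ℝ) (hq : RealRooted q) (x : ℝ) :
    q.eval x = q.leadingCoeff * ∏ i ∈ Finset.range q.roots.card, (x - (sroots q).getD i 0) := by
  conv_lhs => rw [← C_leadingCoeff_mul_prod_multiset_X_sub_C hq]
  rw [eval_mul, eval_C, eval_multiset_prod, Multiset.map_map]
  congr 1
  conv_lhs => rw [← Multiset.sort_eq q.roots (· ≤ ·)]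
  rw [Multiset.map_coe, Multiset.prod_coe, ← sroots_length]
  change (List.map _ (sroots q)).prod = _
  generalize sroots q = l
  induction l with
  | nil => simp
  | cons a t ih =>
    rw [List.map_cons, List.prod_cons, ih, List.length_cons, Finset.prod_range_succ']
    simp [mul_comm]

lemma alt (n : ℕ) (p q : Polynomial ℝ) (h : StrictInterlaces n p q) (k : ℕ) (hk : k + 1 < n) :
    q.eval ((sroots p).getD k 0) * q.eval ((sroots p).getD (k+1) 0) < 0 := by
  obtain ⟨hp, hq, hpd, hqd, h1, h2⟩ := h
  have hpc : p.roots.card = n := by rw [← hpd]; exact hp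
  have hqc : q.roots.card = n := by rw [← hqd]; exact hq
  have hq0 : q ≠ 0 := by rintro rfl; simp at hqc; omega
  rw [eval_sroots q hq, eval_sroots q hq, hqc, mul_mul_mul_comm, ← Finset.prod_mul_distrib]
  have hl : 0 < q.leadingCoeff * q.leadingCoeff :=
    mul_self_pos.2 (leadingCoeff_ne_zero.2 hq0)
  refine mul_neg_of_pos_of_neg hl ?_
  rw [← Finset.mul_prod_erase _ _ (Finset.mem_range.2 (show k < n by omega))]
  refine mul_neg_of_neg_of_pos ?_ (Finset.prod_pos ?_)
  · have := h1 k (by omega)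
    have := h2 k hk
    exact mul_neg_of_neg_of_pos (by linarith) (by linarith)
  · intro i hi
    rw [Finset.mem_erase, Finset.mem_range] at hi
    rcases lt_or_gt_of_ne hi.1 with h | h
    · have a1 := h2 i (by omega)
      have a2 := sroots_mono p (i+1) k (by omega) (by omega)
      have a3 := sroots_mono p k (k+1) (by omega) (by omega)
      exact mul_pos (by linarith) (by linarith)
    · have a1 := h1 i (by omega)
      have a2 := sroots_mono p (k+1) i (by omega) (by omega)
      have a3 := sroots_mono p k (k+1) (by omega) (by omega)
      exact mul_pos_of_neg_of_neg (by linarith) (by linarith)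

lemma core_fwd (n : ℕ) (p q : Polynomial ℝ) (h : StrictInterlaces n p q) (α β : ℝ) :
    RealRooted (C α * p + C β * q) := by
  obtain ⟨hp, hq, hpd, hqd, h1, h2⟩ := id h
  have hpc : p.roots.card = n := by rw [← hpd]; exact hp
  by_cases hβ : β = 0
  · subst hβ
    by_cases hα : α = 0
    · simp [hα, RealRooted]
    · simpa [RealRooted, roots_C_mul _ hα, natDegree_C_mul hα] using hp
  set f := C α * p + C β * q with hf
  by_cases hf0 : f = 0
  · simp [hf0, RealRooted]
  apply rr_of_card
  have hdeg : f.natDegree ≤ n := by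
    refine (natDegree_add_le _ _).trans (max_le ?_ ?_)
    · exact (natDegree_C_mul_le _ _).trans hpd.le
    · exact (natDegree_C_mul_le _ _).trans hqd.le
  have ex : ∀ k, ∃ c, k + 1 < n → (sroots p).getD k 0 < c ∧ c < (sroots p).getD (k+1) 0 ∧
      f.eval c = 0 := by
    intro k
    by_cases hk : k + 1 < n
    swap
    · exact ⟨0, fun h => absurd h hk⟩
    have hp0 : p ≠ 0 := by rintro rfl; simp at hpc; omega
    have hpe : ∀ i, i < n → f.eval ((sroots p).getD i 0) = β * q.eval ((sroots p).getD i 0) := by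
      intro i hi
      have : p.eval ((sroots p).getD i 0) = 0 := (mem_sroots p hp0 _).2 ⟨i, by omega, rfl⟩
      simp only [hf, eval_add, eval_mul, eval_C, this]; ring
    have hneg : f.eval ((sroots p).getD k 0) * f.eval ((sroots p).getD (k+1) 0) < 0 := by
      rw [hpe k (by omega), hpe _ hk, mul_mul_mul_comm]
      exact mul_neg_of_pos_of_neg (mul_self_pos.2 hβ) (alt n p q h k hk)
    have hle := sroots_mono p k (k+1) (by omega) (by omega)
    obtain ⟨c, hc, hc0⟩ : ∃ c ∈ Set.Ioo ((sroots p).getD k 0) ((sroots p).getD (k+1) 0),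
        f.eval c = 0 := by
      rcases mul_neg_iff.1 hneg with h | h
      · exact intermediate_value_Ioo' hle f.continuousOn ⟨h.2, h.1⟩
      · exact intermediate_value_Ioo hle f.continuousOn ⟨h.1, h.2⟩
    exact ⟨c, fun _ => ⟨hc.1, hc.2, hc0⟩⟩
  choose c hc using ex
  have hinj : Set.InjOn c (Finset.range (n-1)) := by
    have key : ∀ i j, i < j → j + 1 < n → c i < c j := by
      intro i j hij hj
      have a1 := (hc i (by omega)).2.1
      have a2 := (hc j hj).1
      have a3 := sroots_mono p (i+1) j (by omega) (by omega)
      linarith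
    intro i hi j hj hij
    simp at hi hj
    rcases lt_trichotomy i j with h | h | h
    · exact absurd hij (key i j h (by omega)).ne
    · exact h
    · exact absurd hij (key j i h (by omega)).ne'
  have hsub : (Finset.range (n-1)).image c ⊆ f.roots.toFinset := by
    intro x hx
    obtain ⟨i, hi, rfl⟩ := Finset.mem_image.1 hx
    rw [Finset.mem_range] at hi
    rw [Multiset.mem_toFinset, mem_roots hf0]
    exact (hc i (by omega)).2.2
  have h3 := Finset.card_le_card hsub
  rw [Finset.card_image_of_injOn hinj, Finset.card_range] at h3
  have h4 := Multiset.toFinset_card_le f.roots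
  omega

lemma weak_main (n : ℕ) : ∀ (p q : Polynomial ℝ)
    (hpd : p.natDegree = n) (hqd : q.natDegree = n)
    (hp : RealRooted p) (hq : RealRooted q),
    ((Interlaces n p q ∨ Interlaces n q p) ↔
      ∀ α β : ℝ, RealRooted (Polynomial.C α * p + Polynomial.C β * q)) := by
  induction n with
  | zero =>
    intro p q hpd hqd hp hq
    refine iff_of_true (Or.inl ⟨hp, hq, hpd, hqd, by omega, by omega⟩) ?_
    intro α β
    apply rr_of_card
    refine ((natDegree_add_le _ _).trans (max_le ?_ ?_)).trans (Nat.zero_le _)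
    · exact (natDegree_C_mul_le _ _).trans hpd.le
    · exact (natDegree_C_mul_le _ _).trans hqd.le
  | succ n ih =>
    intro p q hpd hqd hp hq
    by_cases hc : ∀ x : ℝ, ¬ (p.IsRoot x ∧ q.IsRoot x)
    · have hc' : ∀ x : ℝ, ¬ (q.IsRoot x ∧ p.IsRoot x) := fun x h => hc x h.symm
      constructor
      · rintro (h | h) α β
        · exact core_fwd _ p q (strict_of_weak _ p q hc h) α β
        · rw [add_comm]
          exact core_fwd _ q p (strict_of_weak _ q p hc' h) β α
      · intro hall
        exact (core_back _ (by omega) p q hpd hqd hp hq hc hall).imp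
          (weak_of_strict _ _ _) (weak_of_strict _ _ _)
    · push Not at hc
      obtain ⟨r, hpr, hqr⟩ := hc
      obtain ⟨p1, rfl⟩ := dvd_iff_isRoot.2 hpr
      obtain ⟨q1, rfl⟩ := dvd_iff_isRoot.2 hqr
      have hp0 : p1 ≠ 0 := by rintro rfl; simp at hpd
      have hq0 : q1 ≠ 0 := by rintro rfl; simp at hqd
      rw [natDegree_mul (X_sub_C_ne_zero r) hp0, natDegree_X_sub_C] at hpd
      rw [natDegree_mul (X_sub_C_ne_zero r) hq0, natDegree_X_sub_C] at hqd
      rw [rr_mul] at hp hq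
      rw [interl_mul n r p1 q1 hp hq (by omega) (by omega) hp0 hq0,
        interl_mul n r q1 p1 hq hp (by omega) (by omega) hq0 hp0,
        ih p1 q1 (by omega) (by omega) hp hq]
      refine forall_congr' fun α => forall_congr' fun β => ?_
      rw [← rr_mul r]
      have : (X - C r) * (C α * p1 + C β * q1) =
        C α * ((X - C r) * p1) + C β * ((X - C r) * q1) := by ring
      rw [this]

/-- Hermite–Kakeya–Obreschkoff-type theorem. -/
theorem hko (n : ℕ) (p q : Polynomial ℝ)
    (hpd : p.natDegree = n) (hqd : q.natDegree = n)
    (hp : RealRooted p) (hq : RealRooted q) :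
    ((Interlaces n p q ∨ Interlaces n q p) ↔
      ∀ α β : ℝ, RealRooted (Polynomial.C α * p + Polynomial.C β * q)) ∧
    ((∀ x : ℝ, ¬ (p.IsRoot x ∧ q.IsRoot x)) →
      ((StrictInterlaces n p q ∨ StrictInterlaces n q p) ↔
        ∀ α β : ℝ, ¬ (α = 0 ∧ β = 0) →
          RealRooted (Polynomial.C α * p + Polynomial.C β * q) ∧
          (Polynomial.C α * p + Polynomial.C β * q).roots.Nodup)) := by
  have hw := weak_main n p q hpd hqd hp hq
  refine ⟨hw, fun hc => ?_⟩
  have hc' : ∀ x : ℝ, ¬ (q.IsRoot x ∧ p.IsRoot x) := fun x h => hc x h.symm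
  constructor
  · intro h α β _
    have hall := hw.1 (h.imp (weak_of_strict _ _ _) (weak_of_strict _ _ _))
    exact ⟨hall α β, nodup_of_all p q hc hall α β⟩
  · intro h
    refine (hw.2 fun α β => ?_).imp (strict_of_weak _ _ _ hc) (strict_of_weak _ _ _ hc')
    by_cases h0 : α = 0 ∧ β = 0
    · simp [h0.1, h0.2, RealRooted]
    · exact (h α β h0).1
end

section
/- Let p, p̃, q be real-rooted real polynomials, all of degree exactly n, and suppose p ⪯ p̃. Then p ⊞_n q ⪯ p̃ ⊞_n q. -/
open Polynomial

/-- degree-`n` complex polynomial without zeros in the open upper half plane -/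
def Stab (n : ℕ) (p : ℂ[X]) : Prop :=
  p ≠ 0 ∧ p.natDegree = n ∧ ∀ z : ℂ, 0 < z.im → p.eval z ≠ 0

noncomputable def KK (n : ℕ) (p q : ℂ[X]) (z : ℂ) : ℂ :=
  ∑ k ∈ Finset.range (n + 1), (derivative^[k] p).eval z * (derivative^[n - k] q).eval 0

noncomputable def polar (n : ℕ) (w : ℂ) (q : ℂ[X]) : ℂ[X] :=
  C (n : ℂ) * q - (X - C w) * derivative q

lemma iter_deriv_X_sub (a : ℂ) (p : ℂ[X]) (k : ℕ) :
    derivative^[k] ((X - C a) * p) = (X - C a) * derivative^[k] p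
      + C (k : ℂ) * derivative^[k - 1] p := by
  induction k with
  | zero => simp
  | succ k ih =>
    rw [Function.iterate_succ_apply', ih]
    rcases k with _ | k
    · simp; ring
    · simp only [Nat.add_sub_cancel, Function.iterate_succ_apply', derivative_add, derivative_mul,
        derivative_sub, derivative_X, derivative_C]
      push_cast
      simp only [map_add, map_one]
      ring

lemma KK_rec (n : ℕ) (a z : ℂ) (p q : ℂ[X]) (hp : p.natDegree ≤ n) :
    KK (n + 1) ((X - C a) * p) q z = KK n p (polar (n + 1) (z - a) q) z := by
  have h0 : derivative^[n+1] p = 0 := iterate_derivative_eq_zero (by omega)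
  unfold KK
  simp only [iter_deriv_X_sub, eval_add, eval_mul, eval_sub, eval_X, eval_C, add_mul,
    Finset.sum_add_distrib]
  rw [Finset.sum_range_succ _ (n + 1), h0, Finset.sum_range_succ' (fun k => (k : ℂ) * _ * _) (n + 1)]
  simp only [eval_zero, mul_zero, zero_mul, add_zero, Nat.cast_zero, ← Finset.sum_add_distrib]
  refine Finset.sum_congr rfl fun k hk => ?_
  have hk' : k ≤ n := by simpa [Nat.lt_succ_iff] using hk
  have e1 : n + 1 - k = (n - k) + 1 := by omega
  have e2 : n + 1 - (k + 1) = n - k := by omega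
  have e3 : derivative^[n - k] (polar (n + 1) (z - a) q) =
      C ((n + 1 : ℕ) : ℂ) * derivative^[n-k] q - ((X - C (z - a)) * derivative^[n-k+1] q
        + C ((n - k : ℕ) : ℂ) * derivative^[n-k] q) := by
    unfold polar
    rw [Polynomial.iterate_derivative_sub, iterate_derivative_C_mul, iter_deriv_X_sub]
    rw [← Function.iterate_succ_apply]
    congr 2
    rcases h : n - k with _ | m
    · simp
    · rw [Nat.add_sub_cancel, ← Function.iterate_succ_apply]
  rw [e1, e2, e3]
  simp only [eval_add, eval_mul, eval_sub, eval_X, eval_C, Nat.add_sub_cancel]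
  push_cast [hk']
  ring

lemma stab_roots {n : ℕ} {q : ℂ[X]} (hq : Stab n q) : ∀ b ∈ q.roots, b.im ≤ 0 := by
  intro b hb
  by_contra h
  exact hq.2.2 b (not_le.mp h) (by simpa using (mem_roots'.mp hb).2)

lemma polar_stab (n : ℕ) (w : ℂ) (hw : 0 < w.im) (q : ℂ[X]) (hq : Stab (n + 1) q) :
    Stab n (polar (n + 1) w q) := by
  obtain ⟨hq0, hqd, hqz⟩ := id hq
  have hroots := stab_roots hq
  have hs := IsAlgClosed.splits q
  have hcard : q.roots.card = n + 1 := by rw [splits_iff_card_roots.mp hs, hqd]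
  have hlc : q.coeff (n + 1) ≠ 0 := by
    rw [← hqd]; exact leadingCoeff_ne_zero.mpr hq0
  have hcoeff : ∀ m, (polar (n + 1) w q).coeff m =
      ((n + 1 : ℂ) - m) * q.coeff m + w * ((m + 1 : ℂ) * q.coeff (m + 1)) := by
    intro m
    unfold polar
    rw [sub_mul, coeff_sub, coeff_sub, coeff_C_mul, coeff_C_mul, coeff_derivative]
    rcases m with _ | m
    · simp
    · rw [coeff_X_mul, coeff_derivative]; push_cast; ring
  have hn : (polar (n + 1) w q).coeff n ≠ 0 := by
    have hnc : q.coeff n = - q.coeff (n + 1) * q.roots.sum := by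
      have := hs.nextCoeff_eq_neg_sum_roots_mul_leadingCoeff
      rw [nextCoeff_of_natDegree_pos (by omega), leadingCoeff, hqd] at this
      simpa using this
    rw [hcoeff, hnc]
    have : ((n + 1 : ℂ) - n) * (-q.coeff (n + 1) * q.roots.sum) + w * ((n + 1) * q.coeff (n + 1))
      = q.coeff (n + 1) * ((n + 1) * w - q.roots.sum) := by ring
    rw [this]
    refine mul_ne_zero hlc fun h => ?_
    have h1 := congrArg Complex.im h
    have h2 : (q.roots.sum).im ≤ 0 := by
      have : (q.roots.sum).im = (q.roots.map Complex.im).sum := by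
        simpa using (map_multiset_sum Complex.imAddGroupHom q.roots)
      rw [this]
      have := Multiset.sum_le_card_nsmul (q.roots.map Complex.im) 0 (by
        intro x hx
        obtain ⟨b, hb, rfl⟩ := Multiset.mem_map.mp hx
        exact hroots b hb)
      simpa using this
    simp at h1
    have : 0 < ((n : ℝ) + 1) * w.im := by positivity
    linarith
  have hpol : polar (n + 1) w q ≠ 0 := fun h => hn (by simp [h])
  refine ⟨hpol, ?_, ?_⟩
  · apply natDegree_eq_of_le_of_coeff_ne_zero _ hn
    rw [natDegree_le_iff_coeff_eq_zero]
    intro m hm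
    rw [hcoeff, coeff_eq_zero_of_natDegree_lt (n := m + 1) (by omega)]
    rcases Nat.lt_or_ge (n + 1) m with h | h
    · rw [coeff_eq_zero_of_natDegree_lt (by omega)]; simp
    · have : m = n + 1 := by omega
      subst this; simp
  · intro y hy h0
    have hqy := hqz y hy
    have hd := hs.eval_derivative_eq_eval_mul_sum hqy
    have e : (polar (n + 1) w q).eval y =
        q.eval y * ((n + 1) - (y - w) * (q.roots.map fun z ↦ 1 / (y - z)).sum) := by
      unfold polar
      simp only [eval_sub, eval_mul, eval_X, eval_C, hd]
      push_cast; ring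
    rw [e] at h0
    have h1 := (mul_eq_zero.mp h0).resolve_left hqy
    set U := (q.roots.map fun z ↦ 1 / (y - z)) with hU
    have key : ∀ b : ℂ, b.im ≤ 0 → (1 / (y - b)).im + y.im * Complex.normSq (1 / (y - b)) ≤ 0 := by
      intro b hb
      have hpos : 0 < Complex.normSq (y - b) := by
        rw [Complex.normSq_pos]; intro h
        have := congrArg Complex.im h
        simp at this; linarith
      rw [one_div, Complex.inv_im, Complex.normSq_inv]
      have : -(y - b).im / Complex.normSq (y - b) + y.im * (Complex.normSq (y - b))⁻¹
        = b.im / Complex.normSq (y - b) := by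
        simp only [Complex.sub_im]; ring
      rw [this]
      exact div_nonpos_of_nonpos_of_nonneg hb hpos.le
    -- sum version
    have gen : ∀ M : Multiset ℂ, (∀ u ∈ M, u.im + y.im * Complex.normSq u ≤ 0) →
        M.card * M.sum.im + y.im * Complex.normSq M.sum ≤ 0 := by
      intro M hM
      -- |sum|^2 ≤ card * sum |u|^2
      have a1 : ∀ M : Multiset ℂ, (∀ u ∈ M, u.im + y.im * Complex.normSq u ≤ 0) →
          M.sum.im + y.im * (M.map Complex.normSq).sum ≤ 0 := by
        intro M
        induction M using Multiset.induction_on with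
        | empty => simp
        | cons a s ih =>
          intro h
          have h1 := h a (by simp)
          have h2 := ih fun u hu => h u (by simp [hu])
          simp only [Multiset.sum_cons, Multiset.map_cons, Complex.add_im, mul_add]
          linarith
      have a2 : ∀ M : Multiset ℂ, Complex.normSq M.sum ≤ M.card * (M.map Complex.normSq).sum ∧ 
         ∀ a : ℂ, 2 * (a.re * M.sum.re + a.im * M.sum.im) ≤ M.card * Complex.normSq a + (M.map Complex.normSq).sum := by
        intro M
        induction M using Multiset.induction_on with
        | empty => simp
        | cons a s ih =>
          refine ⟨?_, ?_⟩
          · have h1 := ih.1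
            have h2 := ih.2 a
            simp only [Multiset.sum_cons, Multiset.map_cons, Multiset.card_cons, Complex.normSq_add]
            push_cast
            simp only [Complex.mul_re, Complex.conj_re, Complex.conj_im] 
            linarith
          · intro b
            have h2 := ih.2 b
            simp only [Multiset.sum_cons, Multiset.map_cons, Multiset.card_cons, Complex.add_re, Complex.add_im]
            push_cast
            have : 0 ≤ Complex.normSq (b - a) := Complex.normSq_nonneg _
            simp only [Complex.normSq_apply, Complex.sub_re, Complex.sub_im] at this h2 ⊢
            linarith
      have b1 := a1 M hM
      have b2 := (a2 M).1
      have : (M.card : ℝ) * (M.sum.im + y.im * (M.map Complex.normSq).sum) ≤ 0 :=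
        mul_nonpos_of_nonneg_of_nonpos (by positivity) b1
      nlinarith
    have hfin := gen U (by
      intro u hu
      rw [hU, Multiset.mem_map] at hu
      obtain ⟨b, hb, rfl⟩ := hu
      exact key b (hroots b hb))
    have hcU : (U.card : ℝ) = n + 1 := by rw [hU, Multiset.card_map, hcard]; push_cast; rfl
    rw [hcU] at hfin
    have hyw : (y - w) * U.sum = n + 1 := by linear_combination -h1
    have hyw0 : y - w ≠ 0 := by
      intro h; rw [h, zero_mul] at hyw
      exact Nat.cast_add_one_ne_zero n hyw.symm
    have hUs : U.sum = ((n + 1 : ℝ) : ℂ) * (y - w)⁻¹ := by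
      field_simp; rw [mul_comm]; rw [hyw]; push_cast; rfl
    have hpos : 0 < Complex.normSq (y - w) := Complex.normSq_pos.mpr hyw0
    rw [hUs, Complex.im_ofReal_mul, Complex.normSq_mul, Complex.normSq_ofReal, Complex.inv_im, Complex.normSq_inv] at hfin
    have : ((n:ℝ) + 1) * (((n:ℝ) + 1) * (-(y - w).im / Complex.normSq (y - w))) +
      y.im * (((n:ℝ) + 1) * ((n:ℝ) + 1) * (Complex.normSq (y - w))⁻¹) =
      ((n:ℝ) + 1) * ((n:ℝ) + 1) * w.im * (Complex.normSq (y - w))⁻¹ := by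
      simp only [Complex.sub_im]; ring
    rw [this] at hfin
    have : 0 < ((n:ℝ) + 1) * ((n:ℝ) + 1) * w.im * (Complex.normSq (y - w))⁻¹ := by positivity
    linarith

theorem grace (n : ℕ) : ∀ p q : ℂ[X], Stab n p → Stab n q → ∀ z : ℂ, 0 < z.im →
    KK n p q z ≠ 0 := by
  induction n with
  | zero =>
    intro p q hp hq z hz
    have h1 := hp.2.2 z hz
    have h2 := hq.2.2 z hz
    rw [eq_C_of_natDegree_eq_zero hp.2.1] at h1 ⊢
    rw [eq_C_of_natDegree_eq_zero hq.2.1] at h2 ⊢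
    simp [KK] at h1 h2 ⊢
    exact ⟨h1, h2⟩
  | succ n ih =>
    intro p q hp hq z hz
    obtain ⟨a, ha⟩ := IsAlgClosed.exists_root p (by
      intro h
      have := natDegree_eq_zero_iff_degree_le_zero.mpr h.le
      have := hp.2.1
      omega)
    have ha' : a.im ≤ 0 := by
      by_contra h
      exact hp.2.2 a (not_le.mp h) ha
    obtain ⟨p1, rfl⟩ := dvd_iff_isRoot.mpr ha
    have hp1 : p1 ≠ 0 := right_ne_zero_of_mul hp.1
    have hd : p1.natDegree = n := by
      have := hp.2.1
      rw [natDegree_mul (X_sub_C_ne_zero a) hp1, natDegree_X_sub_C] at this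
      omega
    rw [KK_rec n a z p1 q hd.le]
    refine ih _ _ ⟨hp1, hd, ?_⟩ (polar_stab n (z - a) ?_ q hq) z hz
    · intro y hy h
      exact hp.2.2 y hy (by simp [h])
    · simp; linarith

noncomputable def phi (n : ℕ) (l m : ℕ → ℝ) (s t : ℝ) : ℝ :=
  ∑ j ∈ Finset.range n, (Real.arctan (s * (t - l j)) - Real.arctan (s * (t - m j)))

lemma factor_polar (z : ℂ) (hz : 0 < z.im) (a : ℝ) : ∃ r : ℝ, 0 < r ∧
    z - a = r * (Complex.I * Complex.exp (-(Real.arctan (z.im⁻¹ * (z.re - a)) : ℝ) * Complex.I)) := by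
  set u := z.im⁻¹ * (z.re - a) with hu
  refine ⟨z.im * √(1 + u ^ 2), by positivity, ?_⟩
  have hs : √(1 + u ^ 2) ≠ 0 := by positivity
  have hzu : z.im * u = z.re - a := by rw [hu]; field_simp
  have e : Complex.exp (-(Real.arctan u : ℝ) * Complex.I) =
      ((Real.cos (Real.arctan u) : ℝ) : ℂ) - ((Real.sin (Real.arctan u) : ℝ) : ℂ) * Complex.I := by
    rw [Complex.exp_mul_I]; simp [sub_eq_add_neg]
  rw [e, Real.cos_arctan, Real.sin_arctan]
  apply Complex.ext
  · simp
    field_simp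
    linarith
  · simp
    field_simp

lemma prod_polar (n : ℕ) (z : ℂ) (hz : 0 < z.im) (l : ℕ → ℝ) : ∃ r : ℝ, 0 < r ∧
    ∏ j ∈ Finset.range n, (z - l j) = r * (Complex.I ^ n * Complex.exp
      (-((∑ j ∈ Finset.range n, Real.arctan (z.im⁻¹ * (z.re - l j)) : ℝ)) * Complex.I)) := by
  induction n with
  | zero => exact ⟨1, by simp, by simp⟩
  | succ n ih =>
    obtain ⟨r, hr, h⟩ := ih
    obtain ⟨r', hr', h'⟩ := factor_polar z hz (l n)
    refine ⟨r * r', by positivity, ?_⟩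
    rw [Finset.prod_range_succ, h, h', Finset.sum_range_succ]
    push_cast
    rw [neg_add, add_mul, Complex.exp_add]
    ring

lemma quot_polar (n : ℕ) (z : ℂ) (hz : 0 < z.im) (l m : ℕ → ℝ) : ∃ r : ℝ, 0 < r ∧
    ∏ j ∈ Finset.range n, (z - m j) = (r * Complex.exp ((phi n l m z.im⁻¹ z.re : ℝ) * Complex.I)) *
      ∏ j ∈ Finset.range n, (z - l j) := by
  obtain ⟨r, hr, h⟩ := prod_polar n z hz l
  obtain ⟨r', hr', h'⟩ := prod_polar n z hz m
  refine ⟨r' / r, by positivity, ?_⟩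
  rw [h, h']
  have hr0 : (r : ℂ) ≠ 0 := by exact_mod_cast hr.ne'
  have : Complex.exp (-((∑ j ∈ Finset.range n, Real.arctan (z.im⁻¹ * (z.re - m j)) : ℝ)) * Complex.I)
     = Complex.exp ((phi n l m z.im⁻¹ z.re : ℝ) * Complex.I) * Complex.exp
      (-((∑ j ∈ Finset.range n, Real.arctan (z.im⁻¹ * (z.re - l j)) : ℝ)) * Complex.I) := by
    rw [← Complex.exp_add]
    congr 1
    unfold phi
    rw [Finset.sum_sub_distrib]
    push_cast
    ring
  rw [this]
  push_cast
  field_simp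

/-- forward direction -/
lemma phi_bounds (n : ℕ) (l m : ℕ → ℝ) (h1 : ∀ k, k < n → l k ≤ m k)
    (h2 : ∀ k, k + 1 < n → m k ≤ l (k + 1)) (s t : ℝ) (hs : 0 ≤ s) :
    0 ≤ phi n l m s t ∧ phi n l m s t ≤ Real.pi := by
  have mono : ∀ a b : ℝ, a ≤ b → Real.arctan (s * (t - b)) ≤ Real.arctan (s * (t - a)) := by
    intro a b hab
    apply Real.arctan_strictMono.monotone
    apply mul_le_mul_of_nonneg_left _ hs
    linarith
  constructor
  · apply Finset.sum_nonneg
    intro j hj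
    have := mono _ _ (h1 j (Finset.mem_range.mp hj))
    linarith
  · rcases n with _ | n
    · simp [phi, Real.pi_pos.le]
    · have : ∀ k, k ≤ n → phi (k + 1) l m s t ≤
          Real.arctan (s * (t - l 0)) - Real.arctan (s * (t - m k)) := by
        intro k
        induction k with
        | zero => intro _; simp [phi]
        | succ k ih =>
          intro hk
          have := ih (by omega)
          have h3 := mono _ _ (h2 k (by omega))
          unfold phi at this ⊢
          rw [Finset.sum_range_succ]
          linarith
      have h := this n le_rfl
      have a := Real.arctan_lt_pi_div_two (s * (t - l 0))
      have b := Real.neg_pi_div_two_lt_arctan (s * (t - m n))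
      linarith

lemma phi_cont (n : ℕ) (l m : ℕ → ℝ) (t : ℝ) : Continuous fun s => phi n l m s t := by
  unfold phi
  fun_prop

lemma phi_range (n : ℕ) (l m : ℕ → ℝ) (t : ℝ)
    (h : ∀ s, 0 < s → 0 ≤ Real.sin (phi n l m s t)) (s : ℝ) (hs : 0 < s) :
    0 ≤ phi n l m s t ∧ phi n l m s t ≤ Real.pi := by
  have h0 : phi n l m 0 t = 0 := by simp [phi]
  have hpi := Real.pi_pos
  have hc := (phi_cont n l m t).continuousOn (s := Set.Icc 0 s)
  constructor
  · by_contra hneg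
    push Not at hneg
    have := intermediate_value_Icc' hs.le hc
    obtain ⟨x, hx, hxe⟩ := this (show max (phi n l m s t) (-(Real.pi/2)) ∈ _ by
      rw [h0]; exact ⟨le_max_left _ _, max_le hneg.le (by linarith)⟩)
    simp only at hxe
    have hlt : phi n l m x t < 0 := by rw [hxe]; exact max_lt hneg (by linarith)
    have hgt : -Real.pi < phi n l m x t := by
      rw [hxe]; exact lt_of_lt_of_le (by linarith) (le_max_right _ _)
    have hx0 : 0 < x := by
      rcases hx.1.lt_or_eq with h' | h'
      · exact h'
      · rw [← h', h0] at hlt; exact absurd hlt (lt_irrefl _)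
    exact absurd (h x hx0) (not_le.mpr (Real.sin_neg_of_neg_of_neg_pi_lt hlt hgt))
  · by_contra hneg
    push Not at hneg
    have := intermediate_value_Icc hs.le hc
    obtain ⟨x, hx, hxe⟩ := this (show min (phi n l m s t) (3*Real.pi/2) ∈ _ by
      rw [h0]; exact ⟨le_min (by linarith) (by linarith), min_le_left _ _⟩)
    simp only at hxe
    have hgt : Real.pi < phi n l m x t := by rw [hxe]; exact lt_min hneg (by linarith)
    have hlt : phi n l m x t < 2 * Real.pi := by
      rw [hxe]; exact lt_of_le_of_lt (min_le_right _ _) (by linarith)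
    have hx0 : 0 < x := by
      rcases hx.1.lt_or_eq with h' | h'
      · exact h'
      · rw [← h', h0] at hgt; linarith
    have h1 := h x hx0
    have h2 := Real.sin_neg_of_neg_of_neg_pi_lt (x := phi n l m x t - 2 * Real.pi) (by linarith) (by linarith)
    rw [Real.sin_sub_two_pi] at h2
    linarith

lemma arctan_lim (a : ℝ) : Filter.Tendsto (fun s : ℝ => Real.arctan (s * a)) Filter.atTop
    (nhds (Real.pi / 2 * Real.sign a)) := by
  rcases lt_trichotomy a 0 with h | h | h
  · rw [Real.sign_of_neg h]
    have := (Real.tendsto_arctan_atBot.mono_right nhdsWithin_le_nhds).comp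
      (Filter.tendsto_id.atTop_mul_const_of_neg h)
    simpa [Function.comp_def] using this
  · subst h; simp
  · rw [Real.sign_of_pos h]
    have := (Real.tendsto_arctan_atTop.mono_right nhdsWithin_le_nhds).comp
      (Filter.tendsto_id.atTop_mul_const h)
    simpa [Function.comp_def] using this

lemma sign_sum_bd (n : ℕ) (l m : ℕ → ℝ) (t : ℝ)
    (h : ∀ s, 0 < s → 0 ≤ Real.sin (phi n l m s t)) :
    0 ≤ ∑ j ∈ Finset.range n, (Real.sign (t - l j) - Real.sign (t - m j)) ∧
    ∑ j ∈ Finset.range n, (Real.sign (t - l j) - Real.sign (t - m j)) ≤ 2 := by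
  have hpi := Real.pi_pos
  have lim : Filter.Tendsto (fun s => phi n l m s t) Filter.atTop
      (nhds (Real.pi / 2 * ∑ j ∈ Finset.range n, (Real.sign (t - l j) - Real.sign (t - m j)))) := by
    unfold phi
    rw [Finset.mul_sum]
    apply tendsto_finset_sum
    intro j _
    rw [mul_sub]
    exact (arctan_lim _).sub (arctan_lim _)
  constructor
  · have := ge_of_tendsto lim (Filter.eventually_atTop.mpr ⟨1, fun s hs =>
      (phi_range n l m t h s (by linarith)).1⟩)
    by_contra hc
    push Not at hc
    nlinarith
  · have := le_of_tendsto lim (Filter.eventually_atTop.mpr ⟨1, fun s hs =>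
      (phi_range n l m t h s (by linarith)).2⟩)
    by_contra hc
    push Not at hc
    nlinarith

lemma sign_bd (a : ℝ) : -1 ≤ Real.sign a ∧ Real.sign a ≤ 1 := by
  rcases Real.sign_apply_eq a with h | h | h <;> rw [h] <;> norm_num

lemma backward (n : ℕ) (l m : ℕ → ℝ) (hl : ∀ i j, i ≤ j → j < n → l i ≤ l j)
    (hm : ∀ i j, i ≤ j → j < n → m i ≤ m j)
    (h : ∀ s t, 0 < s → 0 ≤ Real.sin (phi n l m s t)) :
    (∀ k, k < n → l k ≤ m k) ∧ (∀ k, k + 1 < n → m k ≤ l (k + 1)) := by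
  constructor
  · intro k hk
    by_contra hc
    push Not at hc
    obtain ⟨t, ht1, ht2⟩ := exists_between hc
    have := (sign_sum_bd n l m t fun s hs => h s t hs).1
    have hlt : ∑ j ∈ Finset.range n, (Real.sign (t - l j) - Real.sign (t - m j)) <
        ∑ j ∈ Finset.range n, (0 : ℝ) := by
      apply Finset.sum_lt_sum
      · intro j hj
        have hj := Finset.mem_range.mp hj
        have a := sign_bd (t - l j)
        have b := sign_bd (t - m j)
        rcases le_total j k with hjk | hjk
        · have := hm j k hjk hk
          rw [Real.sign_of_pos (r := t - m j) (by linarith)]; linarith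
        · have := hl k j hjk hj
          rw [Real.sign_of_neg (r := t - l j) (by linarith)]; linarith
      · refine ⟨k, Finset.mem_range.mpr hk, ?_⟩
        rw [Real.sign_of_neg (by linarith), Real.sign_of_pos (by linarith)]; norm_num
    simp at hlt
    simp at this
    linarith
  · intro k hk
    by_contra hc
    push Not at hc
    obtain ⟨t, ht1, ht2⟩ := exists_between hc
    have := (sign_sum_bd n l m t fun s hs => h s t hs).2
    have hle : ∑ j ∈ Finset.range n, ((if j = k then (2 : ℝ) else 0) + if j = k + 1 then 2 else 0) ≤
        ∑ j ∈ Finset.range n, (Real.sign (t - l j) - Real.sign (t - m j)) := by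
      apply Finset.sum_le_sum
      intro j hj
      have hj := Finset.mem_range.mp hj
      have a := sign_bd (t - l j)
      have b := sign_bd (t - m j)
      have A : j ≤ k + 1 → Real.sign (t - l j) = 1 := fun hjk => by
        have := hl j (k + 1) hjk hk
        exact Real.sign_of_pos (by linarith)
      have B : k ≤ j → Real.sign (t - m j) = -1 := fun hjk => by
        have := hm k j hjk hj
        exact Real.sign_of_neg (by linarith)
      rcases lt_trichotomy j k with c | c | c
      · rw [A (by omega), if_neg (by omega), if_neg (by omega)]; linarith
      · rw [A (by omega), B (by omega), if_pos c, if_neg (by omega)]; norm_num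
      · rw [B (by omega), if_neg (by omega)]
        split_ifs with d
        · rw [A (by omega)]; norm_num
        · linarith
    rw [Finset.sum_add_distrib, Finset.sum_ite_eq', Finset.sum_ite_eq',
      if_pos (Finset.mem_range.mpr (by omega)), if_pos (Finset.mem_range.mpr (by omega))] at hle
    linarith

lemma list_prod_getD (f : ℝ → ℂ) (L : List ℝ) :
    (L.map f).prod = ∏ j ∈ Finset.range L.length, f (L.getD j 0) := by
  induction L with
  | nil => simp
  | cons a L ih =>
    rw [List.length_cons, Finset.prod_range_succ', List.map_cons, List.prod_cons, ih, mul_comm]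
    simp

noncomputable abbrev mc (p : ℝ[X]) : ℂ[X] := p.map Complex.ofRealHom

lemma eval_rr (n : ℕ) (p : ℝ[X]) (hp : RealRooted p) (hd : p.natDegree = n) (z : ℂ) :
    (mc p).eval z = (p.coeff n : ℝ) * ∏ j ∈ Finset.range n, (z - ((sroots p).getD j 0 : ℝ)) := by
  have hs : p.Splits := splits_iff_card_roots.mpr hp
  have hlen : (sroots p).length = n := by
    unfold sroots; rw [Multiset.length_sort, hp, hd]
  have e : ((sroots p : List ℝ) : Multiset ℝ) = p.roots := Multiset.sort_eq _ _
  have h2 := hs.eq_prod_roots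
  rw [← e, leadingCoeff, hd] at h2
  have := list_prod_getD (fun a => z - (a : ℂ)) (sroots p)
  rw [hlen] at this
  rw [← this]
  conv_lhs => rw [h2]
  simp only [mc, Polynomial.map_mul, eval_mul, map_C, eval_C, Multiset.map_coe, Multiset.prod_coe,
    Polynomial.map_list_prod, eval_list_prod, List.map_map]
  congr 2
  apply List.map_congr_left
  intro a _
  simp

lemma sroots_mono_s8 (n : ℕ) (p : ℝ[X]) (hp : RealRooted p) (hd : p.natDegree = n) :
    ∀ i j, i ≤ j → j < n → (sroots p).getD i 0 ≤ (sroots p).getD j 0 := by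
  intro i j hij hj
  have hlen : (sroots p).length = n := by
    unfold sroots; rw [Multiset.length_sort, hp, hd]
  have hs : (sroots p).Pairwise (· ≤ ·) := Multiset.pairwise_sort _ _
  rw [List.getD_eq_getElem _ _ (by omega), List.getD_eq_getElem _ _ (by omega)]
  rcases hij.lt_or_eq with h | h
  · exact List.pairwise_iff_getElem.mp hs i j (by omega) (by omega) h
  · subst h; exact le_rfl

lemma prod_ne (n : ℕ) (l : ℕ → ℝ) (z : ℂ) (hz : 0 < z.im) :
    ∏ j ∈ Finset.range n, (z - (l j : ℂ)) ≠ 0 := by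
  rw [Finset.prod_ne_zero_iff]
  intro j _ h
  have := congrArg Complex.im h
  simp at this
  linarith

lemma stab_rr (n : ℕ) (p : ℝ[X]) (hp : RealRooted p) (hd : p.natDegree = n) (h0 : p ≠ 0) :
    Stab n (mc p) := by
  have hc : p.coeff n ≠ 0 := by rw [← hd]; exact leadingCoeff_ne_zero.mpr h0
  refine ⟨by simpa [mc, Polynomial.map_eq_zero] using h0, by simp [mc, hd], fun z hz => ?_⟩
  rw [eval_rr n p hp hd]
  exact mul_ne_zero (by exact_mod_cast hc) (prod_ne n _ z hz)

lemma rr_of_no_zero (P : ℝ[X]) (hP : P ≠ 0) (h : ∀ z : ℂ, 0 < z.im → (mc P).eval z ≠ 0) :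
    RealRooted P := by
  unfold RealRooted
  rw [← splits_iff_card_roots]
  apply Splits.of_splits_map Complex.ofRealHom (IsAlgClosed.splits _)
  intro a ha
  have ha : (mc P).eval a = 0 := by simpa using (mem_roots'.mp ha).2
  have him : a.im = 0 := by
    rcases lt_trichotomy a.im 0 with h1 | h1 | h1
    · exfalso
      apply h (starRingEnd ℂ a) (by simpa using h1)
      have hh := congrArg (starRingEnd ℂ) ha
      rw [map_zero] at hh
      rw [← hh]
      simp only [mc, eval_map, eval₂_eq_sum_range, map_sum, map_mul, map_pow, Complex.ofRealHom_eq_coe,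
        Complex.conj_ofReal]
    · exact h1
    · exact absurd ha (h a h1)
  exact ⟨a.re, by apply Complex.ext <;> simp [him]⟩

lemma ffAdd_natDegree_le (n : ℕ) (p q : ℝ[X]) : (ffAdd n p q).natDegree ≤ n := by
  unfold ffAdd
  apply natDegree_sum_le_of_forall_le
  intro k _
  exact (natDegree_C_mul_X_pow_le _ _).trans (Nat.sub_le _ _)

lemma ffAdd_coeff (n : ℕ) (p q : ℝ[X]) : (ffAdd n p q).coeff n = p.coeff n * q.coeff n := by
  unfold ffAdd
  rw [finset_sum_coeff, Finset.sum_eq_single 0]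
  · have : (n.factorial : ℝ) ≠ 0 := by positivity
    rw [coeff_C_mul_X_pow, if_pos (by omega)]
    simp [eCoeff]
    field_simp
    simp
  · intro k hk hk0
    have := Finset.mem_range.mp hk
    rw [coeff_C_mul_X_pow, if_neg (by omega)]
  · simp

lemma ffAdd_KK (n : ℕ) (p q : ℝ[X]) (hp : p.natDegree ≤ n) (z : ℂ) :
    KK n (mc p) (mc q) z = (n.factorial : ℂ) * (mc (ffAdd n p q)).eval z := by
  have hL : KK n (mc p) (mc q) z = ∑ k ∈ Finset.range (n + 1), ∑ m ∈ Finset.range (n - k + 1),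
      (((m + k).factorial : ℂ) / (m.factorial : ℂ) * p.coeff (m + k) * z ^ m) *
        ((n - k).factorial * q.coeff (n - k)) := by
    unfold KK
    refine Finset.sum_congr rfl fun k hk => ?_
    rw [← Finset.sum_mul]
    congr 1
    · rw [eval_eq_sum_range' (n := n - k + 1)]
      · refine Finset.sum_congr rfl fun m _ => ?_
        rw [coeff_iterate_derivative]
        have : (m.factorial : ℂ) ≠ 0 := by exact_mod_cast m.factorial_ne_zero
        have h := Nat.factorial_mul_descFactorial (n := m + k) (k := k) (by omega)
        rw [Nat.add_sub_cancel] at h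
        rw [← h]
        push_cast
        simp only [mc, coeff_map, nsmul_eq_mul, Complex.ofRealHom_eq_coe]
        field_simp
      · have := natDegree_iterate_derivative (mc p) k
        have h2 : (mc p).natDegree ≤ n := natDegree_map_le.trans hp
        omega
    · rw [← coeff_zero_eq_eval_zero, coeff_iterate_derivative]
      simp [mc, Nat.descFactorial_self]
  have hR : (n.factorial : ℂ) * (mc (ffAdd n p q)).eval z =
      ∑ k ∈ Finset.range (n + 1), ∑ l ∈ Finset.range (k + 1),
        ((n - l).factorial : ℂ) * ((n - (k - l)).factorial : ℂ) / ((n - k).factorial : ℂ) *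
          p.coeff (n - l) * q.coeff (n - (k - l)) * z ^ (n - k) := by
    unfold ffAdd mc
    simp only [Polynomial.map_sum, eval_finset_sum, Polynomial.map_mul, map_C, eval_mul, eval_C,
      Polynomial.map_pow, map_X, eval_pow, eval_X, Finset.mul_sum, map_sum, Finset.sum_mul]
    refine Finset.sum_congr rfl fun k hk => Finset.sum_congr rfl fun l hl => ?_
    have hl' : l ≤ k := by simpa [Nat.lt_succ_iff] using hl
    have s : ((-1 : ℂ)) ^ k * ((-1) ^ l * (-1) ^ (k - l)) = 1 := by
      rw [← pow_add, Nat.add_sub_cancel' hl', ← mul_pow]; simp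
    have h1 : (n.factorial : ℂ) ≠ 0 := by exact_mod_cast n.factorial_ne_zero
    have h2 : ((n - k).factorial : ℂ) ≠ 0 := by exact_mod_cast (n - k).factorial_ne_zero
    simp only [eCoeff, Complex.ofRealHom_eq_coe]
    push_cast
    field_simp
    linear_combination (z ^ (n - k) * ((n - l).factorial : ℂ) * ((n - (k - l)).factorial : ℂ) * p.coeff (n - l) * q.coeff (n - (k - l))) * s
  rw [hL, hR, Finset.sum_sigma', Finset.sum_sigma']
  refine Finset.sum_bij' (fun x _ => ⟨n - x.2, n - x.2 - x.1⟩) (fun y _ => ⟨y.1 - y.2, n - y.1⟩)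
    ?_ ?_ ?_ ?_ ?_
  · rintro ⟨k, m⟩ h
    simp at h ⊢
  · rintro ⟨k, m⟩ h
    simp at h ⊢
    omega
  · rintro ⟨k, m⟩ h
    simp at h ⊢
    omega
  · rintro ⟨k, m⟩ h
    simp at h ⊢
    omega
  · rintro ⟨k, m⟩ h
    simp at h
    have e1 : n - (n - m - k) = m + k := by omega
    have e2 : n - (n - m - (n - m - k)) = n - k := by omega
    have e3 : n - (n - m) = m := by omega
    simp only [e1, e2, e3]
    ring

lemma KK_lin (n : ℕ) (a b : ℂ) (p r q : ℂ[X]) (z : ℂ) :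
    KK n (C a * p + C b * r) q z = a * KK n p q z + b * KK n r q z := by
  unfold KK
  rw [Finset.mul_sum, Finset.mul_sum, ← Finset.sum_add_distrib]
  refine Finset.sum_congr rfl fun k _ => ?_
  rw [_root_.iterate_map_add, iterate_derivative_C_mul, iterate_derivative_C_mul]
  simp only [eval_add, eval_mul, eval_C]
  ring

lemma rr_const (p : ℝ[X]) (h : p.natDegree = 0) : RealRooted p := by
  unfold RealRooted
  rw [eq_C_of_natDegree_eq_zero h]; simp

lemma ffAdd_natDegree (n : ℕ) (p q : ℝ[X]) (hp : p.coeff n ≠ 0) (hq : q.coeff n ≠ 0) :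
    (ffAdd n p q).natDegree = n := by
  apply natDegree_eq_of_le_of_coeff_ne_zero (ffAdd_natDegree_le n p q)
  rw [ffAdd_coeff]; exact mul_ne_zero hp hq

lemma ffAdd_rr (n : ℕ) (p q : ℝ[X]) (hp : RealRooted p) (hpd : p.natDegree = n) (hp0 : p ≠ 0)
    (hq : RealRooted q) (hqd : q.natDegree = n) (hq0 : q ≠ 0) : RealRooted (ffAdd n p q) := by
  have key : ∀ z : ℂ, 0 < z.im → (mc (ffAdd n p q)).eval z ≠ 0 := by
    intro z hz h
    apply grace n _ _ (stab_rr n p hp hpd hp0) (stab_rr n q hq hqd hq0) z hz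
    rw [ffAdd_KK n p q hpd.le, h, mul_zero]
  apply rr_of_no_zero _ _ key
  intro h
  exact key Complex.I (by simp) (by simp [h, mc])

/-- preservation of interlacing by the additive finite free convolution. -/
theorem ffAdd_preserves_interlacing (n : ℕ) (p pt q : Polynomial ℝ)
    (hq : RealRooted q) (hqd : q.natDegree = n)
    (h : Interlaces n p pt) :
    Interlaces n (ffAdd n p q) (ffAdd n pt q) := by
  obtain ⟨hp, hpt, hpd, hptd, h1, h2⟩ := h
  rcases Nat.eq_zero_or_pos n with hn | hn
  · subst hn
    have a := Nat.le_zero.mp (ffAdd_natDegree_le 0 p q)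
    have b := Nat.le_zero.mp (ffAdd_natDegree_le 0 pt q)
    exact ⟨rr_const _ a, rr_const _ b, a, b, fun k hk => absurd hk (by omega),
      fun k hk => absurd hk (by omega)⟩
  have hp0 : p ≠ 0 := by rintro rfl; simp at hpd; omega
  have hpt0 : pt ≠ 0 := by rintro rfl; simp at hptd; omega
  have hq0 : q ≠ 0 := by rintro rfl; simp at hqd; omega
  have hc : p.coeff n ≠ 0 := by rw [← hpd]; exact leadingCoeff_ne_zero.mpr hp0
  have hct : pt.coeff n ≠ 0 := by rw [← hptd]; exact leadingCoeff_ne_zero.mpr hpt0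
  have hd : q.coeff n ≠ 0 := by rw [← hqd]; exact leadingCoeff_ne_zero.mpr hq0
  have hP := ffAdd_rr n p q hp hpd hp0 hq hqd hq0
  have hPt := ffAdd_rr n pt q hpt hptd hpt0 hq hqd hq0
  have hPd := ffAdd_natDegree n p q hc hd
  have hPtd := ffAdd_natDegree n pt q hct hd
  have hcC : (p.coeff n : ℂ) ≠ 0 := by exact_mod_cast hc
  have hctC : (pt.coeff n : ℂ) ≠ 0 := by exact_mod_cast hct
  have hdC : (q.coeff n : ℂ) ≠ 0 := by exact_mod_cast hd
  refine ⟨hP, hPt, hPd, hPtd, ?_⟩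
  refine backward n (fun j => (sroots (ffAdd n p q)).getD j 0)
    (fun j => (sroots (ffAdd n pt q)).getD j 0)
    (sroots_mono_s8 n _ hP hPd) (sroots_mono_s8 n _ hPt hPtd) ?_
  -- the pencil is stable
  have pencil : ∀ w : ℂ, w.im < 0 → Stab n (C ((p.coeff n : ℂ)⁻¹) * mc p +
      C (w * (pt.coeff n : ℂ)⁻¹) * mc pt) := by
    intro w hw
    have hco : (C ((p.coeff n : ℂ)⁻¹) * mc p + C (w * (pt.coeff n : ℂ)⁻¹) * mc pt).coeff n
        ≠ 0 := by
      simp only [mc, coeff_add, coeff_C_mul, coeff_map, Complex.ofRealHom_eq_coe]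
      field_simp
      intro h
      have := congrArg Complex.im h
      simp at this
      linarith
    refine ⟨fun h => hco (by rw [h]; simp), ?_, ?_⟩
    · apply natDegree_eq_of_le_of_coeff_ne_zero _ hco
      apply natDegree_add_le_of_degree_le
      · exact (natDegree_C_mul_le _ _).trans (natDegree_map_le.trans hpd.le)
      · exact (natDegree_C_mul_le _ _).trans (natDegree_map_le.trans hptd.le)
    · intro z hz h
      rw [eval_add, eval_mul, eval_mul, eval_C, eval_C, eval_rr n p hp hpd, eval_rr n pt hpt hptd]
        at h
      obtain ⟨r, hr, hq⟩ := quot_polar n z hz (fun j => (sroots p).getD j 0)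
        (fun j => (sroots pt).getD j 0)
      obtain ⟨b1, b2⟩ := phi_bounds n (fun j => (sroots p).getD j 0)
        (fun j => (sroots pt).getD j 0) h1 h2 z.im⁻¹ z.re (by positivity)
      set φ := phi n (fun j => (sroots p).getD j 0)
        (fun j => (sroots pt).getD j 0) z.im⁻¹ z.re
      have hne := prod_ne n (fun j => (sroots p).getD j 0) z hz
      rw [hq] at h
      have h' : (∏ j ∈ Finset.range n, (z - ((sroots p).getD j 0 : ℝ))) *
          (1 + w * (r * Complex.exp (φ * Complex.I))) = 0 := by
        rw [← h]; field_simp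
      have h3 := (mul_eq_zero.mp h').resolve_left hne
      rw [Complex.exp_mul_I, ← Complex.ofReal_cos, ← Complex.ofReal_sin] at h3
      have hre := congrArg Complex.re h3
      have him := congrArg Complex.im h3
      have hsin := Real.sin_nonneg_of_nonneg_of_le_pi b1 b2
      simp [-Complex.ofReal_cos, -Complex.ofReal_sin] at hre him
      have : w.im = r * Real.sin φ * (w.re ^ 2 + w.im ^ 2) := by
        linear_combination w.im * hre - w.re * him
      have : 0 ≤ r * Real.sin φ * (w.re ^ 2 + w.im ^ 2) := by positivity
      linarith
  intro s t hs
  by_contra hneg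
  push Not at hneg
  set z : ℂ := ⟨t, s⁻¹⟩ with hzdef
  have hz : 0 < z.im := by simpa [hzdef] using hs
  obtain ⟨r, hr, hquot⟩ := quot_polar n z hz (fun j => (sroots (ffAdd n p q)).getD j 0)
    (fun j => (sroots (ffAdd n pt q)).getD j 0)
  have e : phi n (fun j => (sroots (ffAdd n p q)).getD j 0)
    (fun j => (sroots (ffAdd n pt q)).getD j 0) z.im⁻¹ z.re = phi n
    (fun j => (sroots (ffAdd n p q)).getD j 0)
    (fun j => (sroots (ffAdd n pt q)).getD j 0) s t := by simp [hzdef]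
  rw [e] at hquot
  set φ := phi n (fun j => (sroots (ffAdd n p q)).getD j 0)
    (fun j => (sroots (ffAdd n pt q)).getD j 0) s t
  have hrC : (r : ℂ) ≠ 0 := by exact_mod_cast hr.ne'
  have hw : (-((r : ℂ)⁻¹ * Complex.exp ((-φ : ℝ) * Complex.I))).im < 0 := by
    rw [Complex.neg_im, ← Complex.ofReal_inv, Complex.im_ofReal_mul, Complex.exp_ofReal_mul_I_im,
      Real.sin_neg]
    have : 0 < r⁻¹ := by positivity
    nlinarith
  apply grace n _ _ (pencil _ hw) (stab_rr n q hq hqd hq0) z hz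
  rw [KK_lin, ffAdd_KK n p q hpd.le, ffAdd_KK n pt q hptd.le, eval_rr n _ hP hPd,
    eval_rr n _ hPt hPtd, hquot, ffAdd_coeff, ffAdd_coeff]
  have hE : Complex.exp ((-φ : ℝ) * Complex.I) = (Complex.exp (φ * Complex.I))⁻¹ := by
    rw [← Complex.exp_neg]; push_cast; ring_nf
  have hE0 := Complex.exp_ne_zero (φ * Complex.I)
  rw [hE]
  push_cast
  field_simp
  ring
end

section
/- Let p be a real polynomial of degree exactly n ≥ 2 all of whose roots are real and simple, and let q be the polynomial of degree n satisfying p ⊞_n q = x^n (the inverse of p under the n-th finite free additive convolution). Then q is not real-rooted, i.e., q has at least one non-real complex root. -/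
open Polynomial

lemma aux_esymm_zero (s : Multiset ℝ) : s.esymm 0 = 1 := by
  simp [Multiset.esymm, Multiset.powersetCard_zero_left]

lemma aux_esymm_one (s : Multiset ℝ) : s.esymm 1 = s.sum := by
  simp [Multiset.esymm, Multiset.powersetCard_one]

lemma aux_esymm_two (s : Multiset ℝ) :
    2 * s.esymm 2 = s.sum ^ 2 - (s.map (fun r => r ^ 2)).sum := by
  induction s using Multiset.induction_on with
  | empty => simp [Multiset.esymm, Multiset.powersetCard_zero_right]
  | cons a s ih =>
    have h : (a ::ₘ s).esymm 2 = s.esymm 2 + a * s.sum := by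
      simp [Multiset.esymm, Multiset.powersetCard_cons, Multiset.powersetCard_one,
        Multiset.map_map]
      simpa using Multiset.sum_map_mul_left (s := s) (a := a) (f := fun x => x)
    rw [h]
    simp only [Multiset.sum_cons, Multiset.map_cons]
    linarith

lemma aux_var (s : Multiset ℝ) (m : ℝ) :
    (s.map (fun r => (r - m) ^ 2)).sum =
      (s.map (fun r => r ^ 2)).sum - 2 * m * s.sum + s.card * m ^ 2 := by
  induction s using Multiset.induction_on with
  | empty => simp
  | cons a s ih =>
    simp only [Multiset.sum_cons, Multiset.map_cons, Multiset.card_cons, ih]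
    push_cast
    ring

lemma aux_nonneg (s : Multiset ℝ) (m : ℝ) : 0 ≤ (s.map (fun r => (r - m) ^ 2)).sum := by
  apply Multiset.sum_nonneg
  intro x hx
  obtain ⟨r, -, rfl⟩ := Multiset.mem_map.1 hx
  positivity

lemma aux_pos (s : Multiset ℝ) (m : ℝ) (hs : s.Nodup) (hc : 2 ≤ s.card) :
    0 < (s.map (fun r => (r - m) ^ 2)).sum := by
  have : ∃ r ∈ s, r ≠ m := by
    by_contra! h
    have h1 := Multiset.eq_replicate_card.2 h
    have h2 := Multiset.nodup_iff_count_le_one.1 hs m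
    rw [h1, Multiset.count_replicate_self] at h2
    omega
  obtain ⟨r, hr, hne⟩ := this
  obtain ⟨t, rfl⟩ := Multiset.exists_cons_of_mem hr
  rw [Multiset.map_cons, Multiset.sum_cons]
  have := aux_nonneg t m
  have : 0 < (r - m) ^ 2 := by
    have := sub_ne_zero.2 hne
    positivity
  linarith

lemma aux_eCoeff (n k : ℕ) (p : Polynomial ℝ) (hpd : p.natDegree = n) (hp : RealRooted p)
    (hk : k ≤ n) : eCoeff n k p = p.leadingCoeff * p.roots.esymm k := by
  unfold eCoeff
  rw [Polynomial.coeff_eq_esymm_roots_of_card hp (by omega), hpd, Nat.sub_sub_self hk]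
  have : ((-1 : ℝ) ^ k) * (-1) ^ k = 1 := by rw [← mul_pow]; simp
  linear_combination (p.leadingCoeff * p.roots.esymm k) * this

lemma aux_coeff (n k : ℕ) (p q : Polynomial ℝ) (hk : k ≤ n) (h : ffAdd n p q = X ^ n) :
    (-1 : ℝ) ^ k *
      ∑ l ∈ Finset.range (k + 1),
        (((n - l).factorial : ℝ) * ((n - (k - l)).factorial : ℝ)) /
            ((n.factorial : ℝ) * ((n - k).factorial : ℝ)) *
          eCoeff n l p * eCoeff n (k - l) q = if k = 0 then 1 else 0 := by
  have h1 := congrArg (fun r => r.coeff (n - k)) h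
  simp only [ffAdd, Polynomial.finsetSum_coeff, Polynomial.coeff_C_mul,
    Polynomial.coeff_X_pow] at h1
  rw [Finset.sum_eq_single k] at h1
  · rw [if_pos rfl, mul_one] at h1
    rw [h1]
    congr 1
    simp only [eq_iff_iff]
    omega
  · intro b hb hne
    rw [Finset.mem_range] at hb
    rw [if_neg (by omega), mul_zero]
  · intro hh
    exact absurd (Finset.mem_range.2 (by omega)) hh

/-- the additive-convolution inverse of a polynomial with simple real roots is
not real-rooted. -/
theorem ffAdd_inverse_not_realRooted (n : ℕ) (hn : 2 ≤ n) (p q : Polynomial ℝ)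
    (hpd : p.natDegree = n) (hp : RealRooted p) (hps : p.roots.Nodup)
    (hqd : q.natDegree = n)
    (hinv : ffAdd n p q = Polynomial.X ^ n) :
    ¬ RealRooted q := by
  intro hq
  have c0 := aux_coeff n 0 p q (by omega) hinv
  have c1 := aux_coeff n 1 p q (by omega) hinv
  have c2 := aux_coeff n 2 p q hn hinv
  obtain ⟨m, rfl⟩ := Nat.exists_eq_add_of_le' hn
  have f1 : ((m + 1).factorial : ℝ) = (m + 1) * m.factorial := by
    rw [Nat.factorial_succ]; push_cast; ring
  have f2 : ((m + 2).factorial : ℝ) = (m + 2) * ((m + 1) * m.factorial) := by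
    rw [Nat.factorial_succ]; push_cast [f1]; ring
  have f0 : (m.factorial : ℝ) ≠ 0 := by positivity
  have g1 : (m + 1 : ℝ) ≠ 0 := by positivity
  have g2 : (m + 2 : ℝ) ≠ 0 := by positivity
  have s1 : m + 2 - 1 = m + 1 := by omega
  simp only [Finset.sum_range_succ, Finset.sum_range_zero, Nat.sub_zero, Nat.sub_self, s1,
    Nat.add_sub_cancel, Nat.reduceSub, Nat.zero_add, Nat.reduceAdd,
    aux_eCoeff _ 0 p hpd hp (by omega), aux_eCoeff _ 0 q hqd hq (by omega),
    aux_eCoeff _ 1 p hpd hp (by omega), aux_eCoeff _ 1 q hqd hq (by omega),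
    aux_eCoeff _ 2 p hpd hp (by omega), aux_eCoeff _ 2 q hqd hq (by omega), f1, f2,
    aux_esymm_one, aux_esymm_zero, mul_one] at c0 c1 c2
  have e1 := aux_esymm_two p.roots
  have e2 := aux_esymm_two q.roots
  have cp : p.roots.card = m + 2 := hp.trans hpd
  have cq : q.roots.card = m + 2 := hq.trans hqd
  have v1 := aux_pos p.roots (p.roots.sum / (m + 2)) hps (by omega)
  have v2 := aux_nonneg q.roots (q.roots.sum / (m + 2))
  rw [aux_var, cp] at v1
  rw [aux_var, cq] at v2
  generalize p.roots.esymm 2 = A2 at *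
  generalize q.roots.esymm 2 = B2 at *
  generalize p.roots.sum = A1 at *
  generalize q.roots.sum = B1 at *
  generalize (p.roots.map (fun r => r ^ 2)).sum = P2 at *
  generalize (q.roots.map (fun r => r ^ 2)).sum = Q2 at *
  generalize p.leadingCoeff = a at *
  generalize q.leadingCoeff = b at *
  push_cast at v1 v2
  field_simp at c0 c1 c2 v1 v2
  norm_num at c0 c1 c2
  have hB : B1 = -A1 := by linear_combination -c1 - (A1 + B1) * c0
  have h2 : ((m : ℝ) + 2) * B2 + (m + 1) * B1 * A1 + (m + 2) * A2 = 0 := by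
    linear_combination c2 - (((m : ℝ) + 2) * B2 + (m + 1) * B1 * A1 + (m + 2) * A2) * c0
  subst hB
  have hA : A2 = (A1 ^ 2 - P2) / 2 := by linarith
  have hB2 : B2 = ((-A1) ^ 2 - Q2) / 2 := by linarith
  subst hA hB2
  nlinarith
end
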